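/- Let $q\geq3$, $m\geq2$, $1\leq t\leq m-1$. The second weight codewords of $R_q(t(q-1),m)$, i.e., those with $|f|=2(q-1)q^{m-t-1}$, are exactly the codewords whose support $S$ is contained in an affine subspace of codimension $t-1$ and, inside it, is either (A) the union of two parallel affine subspaces of codimension $t$ minus their intersection with a non-parallel affine subspace of codimension $t$, or (B) the union of two non-parallel affine subspaces of codimension $t$ minus their intersection. -/

import Mathlib

/-- Membership in the generalized Reed–Muller code `R_q(r,m)`: `f` is represented by a
polynomial of total degree at most `r` (equivalently, its reduced form has degree ≤ r). -/
def RM (F : Type) [Field F] (r m : ℕ) (f : (Fin m → F) → F) : Prop :=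
  ∃ P : MvPolynomial (Fin m) F, P.totalDegree ≤ r ∧ ∀ x, MvPolynomial.eval x P = f x

/-- Hamming weight: the size of the support of `f`. -/
def wt {F : Type} [Field F] [Fintype F] [DecidableEq F] {m : ℕ} (f : (Fin m → F) → F) : ℕ :=
  (Finset.univ.filter fun x => f x ≠ 0).card

open Function

section
variable {F : Type} [Field F] {V : Type} [AddCommGroup V] [Module F V]
  {W : Type} [AddCommGroup W] [Module F W]

/-- functions of degree at most `r`: combinations of products of `r` affine functions -/
def PD (F : Type) [Field F] (V : Type) [AddCommGroup V] [Module F V] (r : ℕ) :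
    Submodule F (V → F) :=
  Submodule.span F {g | ∃ l : Fin r → (V →ᵃ[F] F), g = fun x => ∏ i, l i x}

lemma PD_prod {ι : Type*} (s : Finset ι) (l : ι → (V →ᵃ[F] F)) :
    (fun x => ∏ i ∈ s, l i x) ∈ PD F V s.card := by
  apply Submodule.subset_span
  refine ⟨fun i => l (s.equivFin.symm i), ?_⟩
  funext x
  rw [← Finset.prod_coe_sort]
  exact (Equiv.prod_comp s.equivFin.symm (fun i : s => l i x)).symm

lemma PD_const (c : F) (r : ℕ) : (fun _ : V => c) ∈ PD F V r := by
  have := (PD F V r).smul_mem c (Submodule.subset_span ⟨fun _ => AffineMap.const F V 1, rfl⟩)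
  convert this using 1
  funext x; simp

lemma PD_mul {r s : ℕ} {f g : V → F} (hf : f ∈ PD F V r) (hg : g ∈ PD F V s) :
    (fun x => f x * g x) ∈ PD F V (r + s) := by
  unfold PD at hf hg
  induction hf using Submodule.span_induction with
  | mem f hf =>
    obtain ⟨l, rfl⟩ := hf
    induction hg using Submodule.span_induction with
    | mem g hg =>
      obtain ⟨l', rfl⟩ := hg
      apply Submodule.subset_span
      refine ⟨Fin.append l l', ?_⟩
      funext x
      simp [Fin.prod_univ_add]
    | zero => simpa using PD_const (V := V) (0:F) (r+s)
    | add a b _ _ ha hb => 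
      have := (PD F V (r+s)).add_mem ha hb
      convert this using 1
      funext x; simp [mul_add]
    | smul c a _ ha => 
      have := (PD F V (r+s)).smul_mem c ha
      convert this using 1
      funext x; simp; ring
  | zero => simpa using PD_const (V := V) (0:F) (r+s)
  | add a b _ _ ha hb => 
    have := (PD F V (r+s)).add_mem ha hb
    convert this using 1
    funext x; simp [add_mul]
  | smul c a _ ha => 
    have := (PD F V (r+s)).smul_mem c ha
    convert this using 1
    funext x; simp; ring

lemma PD_mono {r s : ℕ} (h : r ≤ s) : PD F V r ≤ PD F V s := by
  intro f hf
  obtain ⟨k, rfl⟩ := Nat.exists_eq_add_of_le h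
  simpa using PD_mul hf (PD_const (1:F) k)

lemma PD_aff (l : V →ᵃ[F] F) : (fun x => l x) ∈ PD F V 1 := by
  simpa using PD_prod ({()} : Finset Unit) (fun _ => l)

lemma PD_comp {r : ℕ} {f : V → F} (hf : f ∈ PD F V r) (A : W →ᵃ[F] V) :
    (fun x => f (A x)) ∈ PD F W r := by
  unfold PD at hf
  induction hf using Submodule.span_induction with
  | mem f hf =>
    obtain ⟨l, rfl⟩ := hf
    exact Submodule.subset_span ⟨fun i => (l i).comp A, rfl⟩
  | zero => exact (PD F W r).zero_mem
  | add a b _ _ ha hb => exact (PD F W r).add_mem ha hb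
  | smul c a _ ha => exact (PD F W r).smul_mem c ha

lemma PD_zero {f : V → F} (hf : f ∈ PD F V 0) : ∃ c, ∀ x, f x = c := by
  unfold PD at hf
  induction hf using Submodule.span_induction with
  | mem f hf =>
    obtain ⟨l, rfl⟩ := hf
    exact ⟨1, by simp⟩
  | zero => exact ⟨0, by simp⟩
  | add a b _ _ ha hb => 
    obtain ⟨c, hc⟩ := ha
    obtain ⟨d, hd⟩ := hb
    exact ⟨c + d, by simp [hc, hd]⟩
  | smul c a _ ha => 
    obtain ⟨d, hd⟩ := ha
    exact ⟨c * d, by simp [hd]⟩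

lemma PD_one {f : V → F} (hf : f ∈ PD F V 1) : ∃ l : V →ᵃ[F] F, ∀ x, f x = l x := by
  unfold PD at hf
  induction hf using Submodule.span_induction with
  | mem f hf =>
    obtain ⟨l, rfl⟩ := hf
    exact ⟨l 0, by simp⟩
  | zero => exact ⟨0, by simp⟩
  | add a b _ _ ha hb => 
    obtain ⟨c, hc⟩ := ha
    obtain ⟨d, hd⟩ := hb
    exact ⟨c + d, by simp [hc, hd]⟩
  | smul c a _ ha => 
    obtain ⟨d, hd⟩ := ha
    exact ⟨c • d, by simp [hd]⟩

lemma aff_shift (l : V →ᵃ[F] F) (x v : V) (c : F) :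
    l (x + c • v) = l x + c * l.linear v := by
  have := l.map_vadd x (c • v)
  simp at this
  rw [add_comm x, this]; ring

lemma PD_push [Fintype F] {r : ℕ} {f : V → F} (hf : f ∈ PD F V r) (v : V) :
    (fun x => ∑ c : F, f (x + c • v)) ∈ PD F V (r - (Fintype.card F - 1)) ∧
    (r < Fintype.card F - 1 → ∀ x, ∑ c : F, f (x + c • v) = 0) := by
  classical
  unfold PD at hf
  induction hf using Submodule.span_induction with
  | mem f hf =>
    obtain ⟨l, rfl⟩ := hf
    have key : ∀ x, ∑ c : F, ∏ i, l i (x + c • v) =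
        ∑ t ∈ (Finset.univ : Finset (Fin r)).powerset, (∏ i ∈ t, l i x) *
          ((∏ i ∈ Finset.univ \ t, (l i).linear v) * ∑ c : F, c ^ (Finset.univ \ t).card) := by
      intro x
      simp_rw [aff_shift, Finset.prod_add]
      rw [Finset.sum_comm]
      apply Finset.sum_congr rfl
      intro t _
      rw [Finset.mul_sum, Finset.mul_sum]
      apply Finset.sum_congr rfl
      intro c _
      rw [Finset.prod_mul_distrib, Finset.prod_const]; ring
    constructor
    · simp_rw [key]
      have : (fun x => ∑ t ∈ (Finset.univ : Finset (Fin r)).powerset, (∏ i ∈ t, l i x) *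
          ((∏ i ∈ Finset.univ \ t, (l i).linear v) * ∑ c : F, c ^ (Finset.univ \ t).card))
          = ∑ t ∈ (Finset.univ : Finset (Fin r)).powerset, fun x => (∏ i ∈ t, l i x) *
          ((∏ i ∈ Finset.univ \ t, (l i).linear v) * ∑ c : F, c ^ (Finset.univ \ t).card) := by
        funext x; simp
      rw [this]
      apply Submodule.sum_mem
      intro t _
      by_cases ht : (Finset.univ \ t).card < Fintype.card F - 1
      · rw [FiniteField.sum_pow_lt_card_sub_one F _ ht]
        simpa using PD_const (V := V) (0:F) _
      · have h1 : t.card ≤ r - (Fintype.card F - 1) := by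
          have := Finset.card_sdiff_add_card_eq_card (Finset.subset_univ t)
          simp only [Finset.card_univ, Fintype.card_fin] at this
          omega
        have := PD_mul (PD_mono h1 (PD_prod t l)) (PD_const ((∏ i ∈ Finset.univ \ t, (l i).linear v) * ∑ c : F, c ^ (Finset.univ \ t).card) 0)
        simpa using this
    · intro hr x
      rw [key]
      apply Finset.sum_eq_zero
      intro t _
      rw [FiniteField.sum_pow_lt_card_sub_one F]
      · simp
      · refine lt_of_le_of_lt (Finset.card_le_univ _) (by simpa using hr)
  | zero => exact ⟨by simpa using PD_const (V := V) (0:F) _, by simp⟩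
  | add a b _ _ ha hb => 
    refine ⟨?_, ?_⟩
    · convert Submodule.add_mem _ ha.1 hb.1 using 1
      funext x; simp [Finset.sum_add_distrib]
    · intro hr x
      simp [Finset.sum_add_distrib, ha.2 hr x, hb.2 hr x]
  | smul c a _ ha => 
    refine ⟨?_, ?_⟩
    · convert Submodule.smul_mem _ c ha.1 using 1
      funext x; simp [Finset.mul_sum]
    · intro hr x
      simp [← Finset.mul_sum, ha.2 hr x]

lemma PD_split {r : ℕ} {f : V → F} (hf : f ∈ PD F V (r + 1)) (l : V →ᵃ[F] F) (v : V) :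
    ∃ g ∈ PD F V r, ∀ x, f (x + l x • v) = f x + l x * g x := by
  classical
  unfold PD at hf
  induction hf using Submodule.span_induction with
  | mem f hf =>
    obtain ⟨m, rfl⟩ := hf
    -- induction on the number of factors
    have : ∀ (n : ℕ) (m : Fin (n+1) → (V →ᵃ[F] F)), ∃ g ∈ PD F V n,
        ∀ x, ∏ i, m i (x + l x • v) = ∏ i, m i x + l x * g x := by
      intro n
      induction n with
      | zero => 
        intro m
        refine ⟨fun _ => (m 0).linear v, PD_const _ _, ?_⟩
        intro x
        simp [aff_shift]
      | succ n ih =>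
        intro m
        obtain ⟨g, hg, h⟩ := ih (fun i => m i.succ)
        refine ⟨fun x => (m 0).linear v * ∏ i : Fin (n+1), m i.succ x + 
           g x * ((m 0 + (m 0).linear v • l : V →ᵃ[F] F) x), ?_, ?_⟩
        · apply Submodule.add_mem
          · have := PD_mul (PD_const ((m 0).linear v) 0) (PD_prod Finset.univ (fun i : Fin (n+1) => m i.succ))
            simpa using this
          · exact PD_mul hg (PD_aff _)
        · intro x
          rw [Fin.prod_univ_succ, h x, Fin.prod_univ_succ (fun i => m i x), aff_shift]
          simp only [AffineMap.coe_add, AffineMap.coe_smul, Pi.add_apply, Pi.smul_apply, smul_eq_mul]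
          ring
    exact this r m
  | zero => exact ⟨0, Submodule.zero_mem _, by simp⟩
  | add a b _ _ ha hb => 
    obtain ⟨g, hg, h⟩ := ha
    obtain ⟨g', hg', h'⟩ := hb
    exact ⟨g + g', Submodule.add_mem _ hg hg', fun x => by simp [h, h']; ring⟩
  | smul c a _ ha => 
    obtain ⟨g, hg, h⟩ := ha
    exact ⟨c • g, Submodule.smul_mem _ c hg, fun x => by simp [h]; ring⟩
end

set_option linter.unusedSectionVars false
section
variable {F : Type} [Field F] [Fintype F] {V : Type} [AddCommGroup V] [Module F V] [Finite V]

/-- number of nonzeros -/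
noncomputable def NZ {V F : Type} [Zero F] (f : V → F) : ℕ := {x | f x ≠ 0}.ncard

/-- the slice at height `c` -/
def sl (a : V →ₗ[F] F) (w : V) (f : V → F) (c : F) : LinearMap.ker a → F := fun k => f (k + c • w)

open Classical in
/-- heights hit by the support -/
noncomputable def hit (a : V →ₗ[F] F) (f : V → F) : Finset F := Finset.univ.filter fun c => ∃ x, f x ≠ 0 ∧ a x = c

/-- affine inclusion of a slice -/
noncomputable def slA (a : V →ₗ[F] F) (w : V) (c : F) : LinearMap.ker a →ᵃ[F] V :=
  (LinearMap.ker a).subtype.toAffineMap + AffineMap.const F _ (c • w)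

lemma slA_apply (a : V →ₗ[F] F) (w : V) (c : F) (k) : slA a w c k = k + c • w := by simp [slA]

/-- linear map minus constant -/
noncomputable def lmc (a : V →ₗ[F] F) (c : F) : V →ᵃ[F] F := a.toAffineMap + AffineMap.const F _ (-c)

lemma lmc_apply (a : V →ₗ[F] F) (c : F) (x : V) : lmc a c x = a x - c := by
  simp [lmc, sub_eq_add_neg]

lemma mem_hit (a : V →ₗ[F] F) (f : V → F) (c : F) : c ∈ hit a f ↔ ∃ x, f x ≠ 0 ∧ a x = c := by
  simp [hit]

lemma NZ_pos {f : V → F} (hf : f ≠ 0) : 1 ≤ NZ f := by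
  obtain ⟨x, hx⟩ := Function.ne_iff.mp hf
  exact (Set.ncard_pos (Set.toFinite _)).2 ⟨x, hx⟩

lemma sl_card (a : V →ₗ[F] F) (w : V) (haw : a w = 1) (f : V → F) (c : F) :
    NZ (sl a w f c) = {x | f x ≠ 0 ∧ a x = c}.ncard := by
  unfold NZ
  have : {x | f x ≠ 0 ∧ a x = c} = (fun k : LinearMap.ker a => (k:V) + c • w) '' {k | sl a w f c k ≠ 0} := by
    ext x
    constructor
    · rintro ⟨h1, h2⟩
      refine ⟨⟨x - c • w, by simp [haw, h2]⟩, ?_, by simp⟩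
      simpa [sl] using h1
    · rintro ⟨k, hk, rfl⟩
      exact ⟨hk, by simp [haw]⟩
  rw [this, Set.ncard_image_of_injective]
  intro k k' h
  simpa using h

lemma card_hit_sum (a : V →ₗ[F] F) (S : Set V) :
    S.ncard = ∑ c : F, {x | x ∈ S ∧ a x = c}.ncard := by
  classical
  have := Fintype.ofFinite V
  rw [Set.ncard_eq_toFinset_card' S]
  rw [Finset.card_eq_sum_card_fiberwise (f := a) (t := Finset.univ) (by intro; simp)]
  apply Finset.sum_congr rfl
  intro c _
  rw [Set.ncard_eq_toFinset_card']
  congr 1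
  ext x; simp

lemma NZ_eq_sum (a : V →ₗ[F] F) (w : V) (haw : a w = 1) (f : V → F) :
    NZ f = ∑ c ∈ hit a f, NZ (sl a w f c) := by
  have h := card_hit_sum a {x | f x ≠ 0}
  rw [NZ, h]
  symm
  rw [← Finset.sum_subset (Finset.subset_univ (hit a f))]
  · apply Finset.sum_congr rfl
    intro c _
    rw [sl_card a w haw]; rfl
  · intro c _ hc
    rw [mem_hit] at hc
    push Not at hc
    rw [Set.ncard_eq_zero]
    ext x
    simp only [Set.mem_ofPred_eq, Set.mem_empty_iff_false, iff_false, not_and]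
    exact hc x

lemma sl_ne_zero (a : V →ₗ[F] F) (w : V) (haw : a w = 1) (f : V → F) {c : F} (hc : c ∈ hit a f) :
    sl a w f c ≠ 0 := by
  rw [mem_hit] at hc
  obtain ⟨x, hx, hxc⟩ := hc
  apply Function.ne_iff.mpr
  refine ⟨⟨x - c • w, by simp [haw, hxc]⟩, ?_⟩
  simpa [sl] using hx

lemma sl_comb (a : V →ₗ[F] F) (w : V) (haw : a w = 1) {f : V → F} {r : ℕ} (hf : f ∈ PD F V r) (T : Finset F) :
    (fun k : LinearMap.ker a => ∑ c : F, sl a w f c k * ∏ c' ∈ T, (c - c')) ∈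
      PD F (LinearMap.ker a) (r + T.card - (Fintype.card F - 1)) ∧
    (r + T.card < Fintype.card F - 1 → ∀ k, ∑ c : F, sl a w f c k * ∏ c' ∈ T, (c - c') = 0) := by
  have h1 := PD_mul hf (PD_prod T (fun c' => lmc a c'))
  obtain ⟨h2, h3⟩ := PD_push h1 w
  have h4 : ∀ k : LinearMap.ker a, ∑ c : F, f (k + c • w) * ∏ i ∈ T, lmc a i (k + c • w) = 
     ∑ c : F, sl a w f c k * ∏ c' ∈ T, (c - c') := by
    intro k
    apply Finset.sum_congr rfl
    intro c _
    simp [lmc_apply, haw, sl]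
  constructor
  · have := PD_comp h2 (slA a w 0)
    simpa [slA_apply, h4] using this
  · intro h k
    rw [← h4]
    exact h3 h _

lemma sl_PD (a : V →ₗ[F] F) (w : V) (haw : a w = 1) {f : V → F} {r : ℕ} (hf : f ∈ PD F V r) {c : F}
    (hc : c ∈ hit a f) : 
    Fintype.card F ≤ r + (hit a f).card ∧
    sl a w f c ∈ PD F (LinearMap.ker a) (r + (hit a f).card - Fintype.card F)  := by
  classical
  have hq : 1 < Fintype.card F := Fintype.one_lt_card
  obtain ⟨h1, h2⟩ := sl_comb a w haw hf ((hit a f).erase c)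
  have hp : 1 ≤ (hit a f).card := Finset.card_pos.2 ⟨c, hc⟩
  rw [Finset.card_erase_of_mem hc] at h1 h2
  set C := ∏ c' ∈ (hit a f).erase c, (c - c') with hC
  have hC0 : C ≠ 0 := by
    rw [hC, Finset.prod_ne_zero_iff]
    intro c' hc' h
    rw [sub_eq_zero] at h
    simp [h] at hc'
  have key : ∀ k, ∑ d : F, sl a w f d k * ∏ c' ∈ (hit a f).erase c, (d - c') = sl a w f c k * C := by
    intro k
    apply Finset.sum_eq_single c
    · intro d _ hd
      by_cases hdh : d ∈ hit a f
      · rw [Finset.prod_eq_zero (i := d)]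
        · simp
        · simp [hd, hdh]
        · simp
      · have : sl a w f d k = 0 := by
          by_contra h
          apply hdh
          rw [mem_hit]
          exact ⟨_, h, by simp [haw]⟩
        simp [this]
    · simp
  constructor
  · by_contra! hlt
    apply sl_ne_zero a w haw f hc
    funext k
    have := h2 (by omega) k
    rw [key] at this
    simpa [hC0] using this
  · simp_rw [key] at h1
    have h3 := (PD F _ _).smul_mem C⁻¹ h1
    have e : r + ((hit a f).card - 1) - (Fintype.card F - 1) = r + (hit a f).card - Fintype.card F := by omega
    rw [e] at h3
    convert h3 using 1
    funext k
    simp [field]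

lemma hit_nonempty (a : V →ₗ[F] F) {f : V → F} (hf : f ≠ 0) : (hit a f).Nonempty := by
  obtain ⟨x, hx⟩ := Function.ne_iff.mp hf
  exact ⟨a x, (mem_hit _ _ _).2 ⟨x, hx, rfl⟩⟩

lemma hit_le (a : V →ₗ[F] F) (f : V → F) : (hit a f).card ≤ Fintype.card F := Finset.card_le_univ _

lemma exists_w {a : V →ₗ[F] F} (ha : a ≠ 0) : ∃ w, a w = 1 := by
  obtain ⟨x, hx⟩ : ∃ x, a x ≠ 0 := by
    by_contra! h
    exact ha (LinearMap.ext h)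
  exact ⟨(a x)⁻¹ • x, by simp [hx]⟩

lemma ne_of_w {a : V →ₗ[F] F} {w : V} (h : a w = 1) : a ≠ 0 := by
  rintro rfl; simp at h

lemma finrank_ker' {a : V →ₗ[F] F} (ha : a ≠ 0) : 
    Module.finrank F (LinearMap.ker a) + 1 = Module.finrank F V := 
  Module.Dual.finrank_ker_add_one_of_ne_zero ha

lemma exists_dual (h : 1 ≤ Module.finrank F V) : ∃ a : V →ₗ[F] F, a ≠ 0 := by
  have : Nontrivial V := Module.nontrivial_of_finrank_pos (R := F) h
  exact exists_ne (0 : Module.Dual F V)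

lemma card_V : Nat.card V = Fintype.card F ^ Module.finrank F V := by
  rw [← Nat.card_eq_fintype_card]; exact Module.natCard_eq_pow_finrank

lemma NZ_le (f : V → F) : NZ f ≤ Fintype.card F ^ Module.finrank F V := by
  rw [← card_V]
  exact Set.ncard_le_card _

/-- minimum weight bound -/
lemma minwt : ∀ (n : ℕ) (V : Type) [AddCommGroup V] [Module F V] [Finite V], Module.finrank F V = n →
    ∀ (a b : ℕ) (f : V → F), b ≤ Fintype.card F - 1 → a < n → f ≠ 0 → 
    f ∈ PD F V (a * (Fintype.card F - 1) + b) → 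
    (Fintype.card F - b) * Fintype.card F ^ (n - 1 - a) ≤ NZ f := by
  intro n
  induction n with
  | zero => intro V _ _ _ _ a b f _ h; omega
  | succ n ih =>
    intro V _ _ _ hV a b f hb ha hf0 hf
    have hq : 1 < Fintype.card F := Fintype.one_lt_card
    obtain ⟨u, hu⟩ := exists_dual (F := F) (V := V) (by omega)
    obtain ⟨w, hw⟩ := exists_w hu
    have hK := finrank_ker' hu
    rw [NZ_eq_sum u w hw]
    obtain ⟨c0, hc0⟩ := hit_nonempty u hf0
    have hjq := hit_le u f
    have hj1 : 1 ≤ (hit u f).card := Finset.card_pos.2 ⟨c0, hc0⟩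
    have hd := fun c (hc : c ∈ hit u f) => sl_PD u w hw hf hc
    have hn0 := fun c (hc : c ∈ hit u f) => sl_ne_zero u w hw f hc
    set j := (hit u f).card with hj
    set q := Fintype.card F with hqdef
    obtain ⟨z, hz⟩ := Nat.exists_eq_add_of_le hjq
    have hq' : q = (q - 1) + 1 := by omega
    by_cases hzb : z ≤ b
    · by_cases han : a = n
      · subst han
        have : ∀ c ∈ hit u f, 1 ≤ NZ (sl u w f c) := fun c hc => NZ_pos (hn0 c hc)
        have h2 := Finset.card_nsmul_le_sum _ _ _ this
        simp only [smul_eq_mul, mul_one] at h2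
        refine le_trans ?_ h2
        simp; omega
      · have : ∀ c ∈ hit u f, (q - (b - z)) * q ^ (n - 1 - a) ≤ NZ (sl u w f c) := by
          intro c hc
          apply ih _ (by omega) a (b - z) _ (by omega) (by omega) (hn0 c hc)
          have := (hd c hc).2
          convert this using 2
          omega
        have h2 := Finset.card_nsmul_le_sum _ _ _ this
        refine le_trans ?_ h2
        have e : n + 1 - 1 - a = (n - 1 - a) + 1 := by omega
        rw [e, pow_succ, smul_eq_mul, ← hj]
        rw [show (q - b) * (q ^ (n-1-a) * q) = ((q-b)*q) * q ^ (n-1-a) by ring, ← mul_assoc]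
        apply Nat.mul_le_mul_right
        obtain ⟨y, rfl⟩ := Nat.exists_eq_add_of_le hzb
        have e1 : q - (z + y - z) = q - y := by omega
        rw [e1]
        obtain ⟨s, hs⟩ : ∃ s, q = z + y + s := ⟨q - (z+y), by omega⟩
        have : j = y + s := by omega
        rw [this, hs, show z + y + s - (z+y) = s by omega, show z + y + s - y = z + s by omega]
        nlinarith
    · have ha1 : 1 ≤ a := by
        by_contra h
        have : a = 0 := by omega
        subst this
        have := (hd c0 hc0).1
        omega
      obtain ⟨a, rfl⟩ := Nat.exists_eq_add_of_le' ha1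
      have : ∀ c ∈ hit u f, (q - (b + (q - 1) - z)) * q ^ (n - 1 - a) ≤ NZ (sl u w f c) := by
        intro c hc
        apply ih _ (by omega) a (b + (q - 1) - z) _ (by omega) (by omega) (hn0 c hc)
        have := (hd c hc).2
        convert this using 2
        have : (a + 1) * (q - 1) = a * (q - 1) + (q - 1) := by ring
        omega
      have h2 := Finset.card_nsmul_le_sum _ _ _ this
      refine le_trans ?_ h2
      have e : n + 1 - 1 - (a + 1) = (n - 1 - a) := by omega
      rw [e, smul_eq_mul, ← hj, ← mul_assoc]
      apply Nat.mul_le_mul_right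
      obtain ⟨y, rfl⟩ := Nat.exists_eq_add_of_le (not_le.1 hzb).le
      have e1 : q - (b + (q - 1) - (b + y)) = y + 1 := by omega
      rw [e1, show q - b = j + y by omega]
      nlinarith
end

set_option linter.unusedSectionVars false
section
variable {F : Type} [Field F] [Fintype F] {V : Type} [AddCommGroup V] [Module F V] [Finite V]

/-- projection to the kernel along `w` -/
noncomputable def prj (a : V →ₗ[F] F) (w : V) (haw : a w = 1) : V →ₗ[F] LinearMap.ker a :=
  LinearMap.codRestrict (LinearMap.ker a) (LinearMap.id - a.smulRight w) (by intro x; simp [haw])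

lemma prj_coe (a : V →ₗ[F] F) (w : V) (haw : a w = 1) (x : V) :
    (prj a w haw x : V) = x - a x • w := by
  rfl

lemma prj_ker (a : V →ₗ[F] F) (w : V) (haw : a w = 1) (k : LinearMap.ker a) (c : F) :
    prj a w haw (k + c • w) = k := by
  ext; rw [prj_coe]; simp [haw]

lemma cut_card (f : V → F) (a : V →ₗ[F] F) (c : F) :
    NZ f = NZ (fun x => f x * lmc a c x) + {x | f x ≠ 0 ∧ a x = c}.ncard := by
  unfold NZ
  rw [← Set.ncard_union_eq]
  · congr 1
    ext x
    simp only [Set.mem_ofPred_eq, Set.mem_union, lmc_apply, mul_ne_zero_iff, sub_ne_zero]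
    tauto
  · rw [Set.disjoint_left]
    intro x
    simp only [Set.mem_ofPred_eq, lmc_apply, mul_ne_zero_iff, sub_ne_zero]
    tauto

lemma cut_PD {r : ℕ} {f : V → F} (hf : f ∈ PD F V r) (a : V →ₗ[F] F) (c : F) :
    (fun x => f x * lmc a c x) ∈ PD F V (r + 1) := PD_mul hf (PD_aff _)

lemma dual_ker_card {v : V} (hv : v ≠ 0) : 
    Nat.card (LinearMap.ker (Module.Dual.eval F V v)) = Fintype.card F ^ (Module.finrank F V - 1) := by
  have : Finite (Module.Dual F V) := Module.finite_of_finite F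
  have h : Module.Dual.eval F V v ≠ 0 := by
    intro h
    apply hv
    rw [← Module.forall_dual_apply_eq_zero_iff F]
    intro g
    exact DFunLike.congr_fun h g
  have h2 := finrank_ker' h
  rw [Subspace.dual_finrank_eq] at h2
  rw [card_V (F := F)]
  congr 1
  omega

lemma exists_low (S : Set V) (hS : S.Nonempty) (hS2 : S.ncard < Fintype.card F ^ Module.finrank F V) :
    ∃ (a : V →ₗ[F] F) (c : F), a ≠ 0 ∧ Fintype.card F * {x | x ∈ S ∧ a x = c}.ncard < S.ncard := by
  classical
  have : Finite (Module.Dual F V) := Module.finite_of_finite F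
  have := Fintype.ofFinite V
  have := Fintype.ofFinite (Module.Dual F V)
  have hq : 1 < Fintype.card F := Fintype.one_lt_card
  obtain ⟨p, hp⟩ : ∃ p, p ∉ S := by
    by_contra! h
    rw [← card_V, Set.eq_univ_of_forall h, Set.ncard_univ] at hS2
    exact lt_irrefl _ hS2
  have hS0 : 0 < S.ncard := (Set.ncard_pos (Set.toFinite _)).2 hS
  have hn : 1 ≤ Module.finrank F V := by
    by_contra h
    have : Module.finrank F V = 0 := by omega
    rw [this] at hS2
    simp at hS2
    omega
  by_contra! hcon
  have h1 := Finset.sum_card_bipartiteAbove_eq_sum_card_bipartiteBelow 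
    (s := (Finset.univ : Finset (Module.Dual F V))) (t := S.toFinset) (fun a x => a x = a p)
  have h2 : ∑ b ∈ S.toFinset, (Finset.univ.bipartiteBelow (fun (a : Module.Dual F V) x => a x = a p) b).card 
     = S.ncard * Fintype.card F ^ (Module.finrank F V - 1) := by
    rw [Finset.sum_const_nat (m := Fintype.card F ^ (Module.finrank F V - 1)), Set.ncard_eq_toFinset_card']
    intro x hx
    rw [Set.mem_toFinset] at hx
    have hne : x - p ≠ 0 := by
      intro h; rw [sub_eq_zero] at h; exact hp (h ▸ hx)
    rw [← dual_ker_card (F := F) hne, Nat.card_eq_fintype_card, Fintype.card_subtype]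
    congr 1
    ext a
    simp [Finset.bipartiteBelow, sub_eq_zero]
  have h3 : ∀ a : Module.Dual F V, (S.toFinset.bipartiteAbove (fun (a : Module.Dual F V) x => a x = a p) a).card 
      = {x | x ∈ S ∧ a x = a p}.ncard := by
    intro a
    rw [Set.ncard_eq_toFinset_card']
    congr 1
    ext x; simp [Finset.bipartiteAbove]
  rw [h2] at h1
  simp_rw [h3] at h1
  rw [← Finset.add_sum_erase _ _ (Finset.mem_univ 0)] at h1
  have h4 : {x | x ∈ S ∧ (0 : Module.Dual F V) x = (0 : Module.Dual F V) p} = S := by ext; simp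
  rw [h4] at h1
  have h5 : ∀ a ∈ (Finset.univ : Finset (Module.Dual F V)).erase 0, S.ncard ≤ Fintype.card F * {x | x ∈ S ∧ a x = a p}.ncard := by
    intro a ha
    exact hcon a (a p) (by simpa using ha)
  have h6 := Finset.card_nsmul_le_sum _ _ _ h5
  rw [← Finset.mul_sum, Finset.card_erase_of_mem (Finset.mem_univ _), Finset.card_univ, ← Nat.card_eq_fintype_card, card_V (F := F), Subspace.dual_finrank_eq, smul_eq_mul] at h6
  set A := ∑ a ∈ (Finset.univ : Finset (Module.Dual F V)).erase 0, {x | x ∈ S ∧ a x = a p}.ncard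
  obtain ⟨n, hn'⟩ := Nat.exists_eq_add_of_le' hn
  rw [hn'] at h6 h1
  simp only [Nat.add_sub_cancel] at h1
  set q := Fintype.card F
  set s := S.ncard
  have h7 : q ^ (n+1) = q * q ^ n := by ring
  have h8 : 0 < q ^ n := by positivity
  have h9 : (q ^ (n+1) - 1) * s = q ^ (n+1) * s - s := by rw [Nat.sub_mul, one_mul]
  rw [h9, h7] at h6
  have h10 : q * (s + A) = q * (s * q ^ n) := by rw [h1]
  have : q * q ^ n * s = q * (s * q^n) := by ring
  have h11 : s < q * s := by nlinarith
  have h12 : q * (s + A) = q * s + q * A := by ring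
  omega

lemma exists_low' {f : V → F} (hf : f ≠ 0) (hS2 : NZ f < Fintype.card F ^ Module.finrank F V) :
    ∃ (a : V →ₗ[F] F) (w : V) (c : F), a w = 1 ∧ Fintype.card F * NZ (sl a w f c) < NZ f := by
  obtain ⟨x, hx⟩ := Function.ne_iff.mp hf
  obtain ⟨a, c, ha, h⟩ := exists_low {x | f x ≠ 0} ⟨x, hx⟩ hS2
  obtain ⟨w, hw⟩ := exists_w ha
  refine ⟨a, w, c, hw, ?_⟩
  rw [sl_card a w hw]
  exact h

lemma hit_univ {a : V →ₗ[F] F} {f : V → F} (h : Fintype.card F ≤ (hit a f).card) (c : F) : c ∈ hit a f := by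
  have : hit a f = Finset.univ := Finset.card_eq_iff_eq_univ _ |>.1 (le_antisymm (hit_le a f) h)
  rw [this]; exact Finset.mem_univ _

lemma hit_one {a : V →ₗ[F] F} {f : V → F} (h : (hit a f).card = 1) : ∃ c, ∀ x, f x ≠ 0 → a x = c := by
  obtain ⟨c, hc⟩ := Finset.card_eq_one.1 h
  refine ⟨c, fun x hx => ?_⟩
  have : a x ∈ hit a f := (mem_hit _ _ _).2 ⟨x, hx, rfl⟩
  rw [hc] at this
  simpa using this

lemma L11 {d : ℕ} (hd : d + 2 ≤ Fintype.card F) (hn : 2 ≤ Module.finrank F V) {f : V → F}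
    (hf : f ∈ PD F V d) (hN : NZ f = (Fintype.card F - d) * Fintype.card F ^ (Module.finrank F V - 1)) :
    ∃ (a : V →ₗ[F] F) (J : Finset F), a ≠ 0 ∧ J.card = Fintype.card F - d ∧ ∀ x, f x ≠ 0 ↔ a x ∈ J := by
  have hq : 1 < Fintype.card F := Fintype.one_lt_card
  obtain ⟨n, hn'⟩ := Nat.exists_eq_add_of_le' hn
  have hf0 : f ≠ 0 := by
    rintro rfl
    simp [NZ] at hN
    omega
  rcases Nat.eq_zero_or_pos d with rfl | hd0
  · obtain ⟨a, ha⟩ := exists_dual (F := F) (V := V) (by omega)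
    refine ⟨a, Finset.univ, ha, by simp, ?_⟩
    obtain ⟨c, hc⟩ := PD_zero hf
    obtain ⟨y, hy⟩ := Function.ne_iff.mp hf0
    intro x
    rw [hc] at hy ⊢
    simpa using hy
  rw [hn'] at hN
  simp only [show n + 2 - 1 = n + 1 by omega] at hN
  set q := Fintype.card F with hqd
  have hlt : NZ f < q ^ (n + 2) := by
    rw [hN, pow_succ q (n+1), mul_comm]
    apply Nat.mul_lt_mul_of_pos_left (by omega) (by positivity)
  obtain ⟨a, w, c, hw, hlow⟩ := exists_low' hf0 (by rw [hn']; exact hlt)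
  rw [← hqd] at hlow
  have ha := ne_of_w hw
  have hK := finrank_ker' ha
  have hd' := fun c (hc : c ∈ hit a f) => sl_PD a w hw hf hc
  have hn0 := fun c (hc : c ∈ hit a f) => sl_ne_zero a w hw f hc
  have hS := NZ_eq_sum a w hw f
  obtain ⟨c0, hc0⟩ := hit_nonempty a hf0
  have hj1 : 1 ≤ (hit a f).card := Finset.card_pos.2 ⟨c0, hc0⟩
  have hjq := hit_le a f
  have hdj := (hd' c0 hc0).1
  have hw' : ∀ c ∈ hit a f, (q - (d + (hit a f).card - q)) * q ^ n ≤ NZ (sl a w f c) := by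
    intro c hc
    have := minwt (n+1) (LinearMap.ker a) (by omega) 0 (d + (hit a f).card - q) (sl a w f c) (by omega) (by omega) (hn0 c hc) (by simpa using (hd' c hc).2)
    simpa using this
  have hup : ∀ c, NZ (sl a w f c) ≤ q ^ (n+1) := by
    intro c
    have := NZ_le (sl a w f c)
    rwa [show Module.finrank F (LinearMap.ker a) = n + 1 by omega] at this
  set j := (hit a f).card with hj
  have hjlt : j < q := by
    by_contra h
    have hm := hit_univ (not_lt.1 h) c
    have h2 := hw' c hm
    have : d + j - q = d := by omega
    rw [this] at h2
    have : (q - d) * q ^ (n+1) = q * ((q - d) * q ^ n) := by ring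
    have h3 : q * ((q - d) * q ^ n) ≤ q * NZ (sl a w f c) := Nat.mul_le_mul_left _ h2
    omega
  have hsum := Finset.card_nsmul_le_sum _ _ _ hw'
  rw [← hS, hN, smul_eq_mul, ← hj] at hsum
  have hnum : j * (q - (d + j - q)) ≤ q * (q - d) := by
    have : 0 < q ^ n := by positivity
    apply Nat.le_of_mul_le_mul_right _ this
    calc _ = j * ((q - (d + j - q)) * q ^ n) := by ring
      _ ≤ _ := hsum
      _ = _ := by ring
  have hjd : j = q - d := by
    obtain ⟨y, hy⟩ := Nat.exists_eq_add_of_le hdj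
    obtain ⟨s, hs⟩ := Nat.exists_eq_add_of_lt hjlt
    have e1 : d + j - q = y := by omega
    rw [e1] at hnum
    have e2 : d = y + s + 1 := by omega
    have e3 : q - y = j + s + 1 - y := by omega
    have e4 : q - d = j - y := by omega
    have e5 : y ≤ j := by omega
    obtain ⟨z, hz⟩ := Nat.exists_eq_add_of_le e5
    have e6 : q - y = z + s + 1 := by omega
    have e7 : q - d = z := by omega
    have e8 : q = y + z + s + 1 := by omega
    rw [e6, e7, hz, e8] at hnum
    have : y * (s + 1) ≤ 0 := by nlinarith
    have : y = 0 := by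
      by_contra h
      have : 0 < y * (s + 1) := by positivity
      omega
    omega
  refine ⟨a, hit a f, ha, hjd, ?_⟩
  have hfull : ∀ c ∈ hit a f, NZ (sl a w f c) = q ^ (n+1) := by
    by_contra! h
    obtain ⟨c1, hc1, hc1'⟩ := h
    have : ∑ c ∈ hit a f, NZ (sl a w f c) < ∑ c ∈ hit a f, q ^ (n+1) := 
      Finset.sum_lt_sum (fun c _ => hup c) ⟨c1, hc1, lt_of_le_of_ne (hup c1) hc1'⟩
    rw [← hS, hN, Finset.sum_const, smul_eq_mul, ← hj, hjd] at this
    exact lt_irrefl _ this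
  intro x
  constructor
  · intro hx
    exact (mem_hit _ _ _).2 ⟨x, hx, rfl⟩
  · intro hx
    have h1 := hfull _ hx
    have h2 : {k | sl a w f (a x) k ≠ 0} = Set.univ := by
      rw [Set.eq_univ_iff_ncard]
      unfold NZ at h1
      rw [h1, card_V (F := F), show Module.finrank F (LinearMap.ker a) = n + 1 by omega]
    have h3 : prj a w hw x ∈ {k | sl a w f (a x) k ≠ 0} := by rw [h2]; trivial
    simpa [sl, prj_coe] using h3

lemma L12 (hn : 1 ≤ Module.finrank F V) {f : V → F} (hf0 : f ≠ 0)
    (hf : f ∈ PD F V (Fintype.card F - 1)) (hN : NZ f ≤ Fintype.card F ^ (Module.finrank F V - 1)) :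
    ∃ (a : V →ₗ[F] F) (c : F), a ≠ 0 ∧ ∀ x, f x ≠ 0 → a x = c := by
  have hq : 1 < Fintype.card F := Fintype.one_lt_card
  obtain ⟨n, hn'⟩ := Nat.exists_eq_add_of_le' hn
  rw [hn'] at hN
  simp only [Nat.add_sub_cancel] at hN
  set q := Fintype.card F with hqd
  obtain ⟨a, w, c, hw, hlow⟩ := exists_low' hf0 (by rw [hn']; exact lt_of_le_of_lt hN (Nat.pow_lt_pow_right hq (by omega)))
  rw [← hqd] at hlow
  have ha := ne_of_w hw
  have hK := finrank_ker' ha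
  have hd' := fun c (hc : c ∈ hit a f) => sl_PD a w hw hf hc
  have hn0 := fun c (hc : c ∈ hit a f) => sl_ne_zero a w hw f hc
  have hS := NZ_eq_sum a w hw f
  obtain ⟨c0, hc0⟩ := hit_nonempty a hf0
  have hj1 : 1 ≤ (hit a f).card := Finset.card_pos.2 ⟨c0, hc0⟩
  have hjq := hit_le a f
  suffices (hit a f).card = 1 by
    obtain ⟨c, hc⟩ := hit_one this
    exact ⟨a, c, ha, hc⟩
  set j := (hit a f).card with hj
  rcases n with _ | n
  · have h1 : ∀ c ∈ hit a f, 1 ≤ NZ (sl a w f c) := fun c hc => NZ_pos (hn0 c hc)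
    have h2 := Finset.card_nsmul_le_sum _ _ _ h1
    rw [← hS] at h2
    simp only [smul_eq_mul, ← hj] at h2
    simp at hN
    omega
  have hw' : ∀ c ∈ hit a f, (q - (j - 1)) * q ^ n ≤ NZ (sl a w f c) := by
    intro c hc
    have := minwt (n+1) (LinearMap.ker a) (by omega) 0 (j - 1) (sl a w f c) (by omega) (by omega) (hn0 c hc) (by convert (hd' c hc).2 using 2; omega)
    simpa using this
  have hjlt : j < q := by
    by_contra h
    have hm := hit_univ (not_lt.1 h) c
    have h2 := hw' c hm
    have : q - (j - 1) = 1 := by omega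
    rw [this, one_mul] at h2
    have : q ^ (n+1) = q * (q ^ n) := by ring
    have h3 : q * (q ^ n) ≤ q * NZ (sl a w f c) := Nat.mul_le_mul_left _ h2
    omega
  have hsum := Finset.card_nsmul_le_sum _ _ _ hw'
  rw [← hS, smul_eq_mul, ← hj] at hsum
  have hnum : j * (q - (j - 1)) ≤ q := by
    have : 0 < q ^ n := by positivity
    apply Nat.le_of_mul_le_mul_right _ this
    calc _ = j * ((q - (j - 1)) * q ^ n) := by ring
      _ ≤ _ := hsum
      _ ≤ _ := hN
      _ = _ := by ring
  obtain ⟨s, hs⟩ := Nat.exists_eq_add_of_lt hjlt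
  obtain ⟨y, hy⟩ := Nat.exists_eq_add_of_le' hj1
  have e1 : q - (j - 1) = s + 2 := by omega
  rw [e1, hy] at hnum
  have e2 : q = y + s + 2 := by omega
  rw [e2] at hnum
  have : y * (s + 1) ≤ 0 := by nlinarith
  have : y = 0 := by
    by_contra h
    have : 0 < y * (s + 1) := by positivity
    omega
  omega
end

set_option linter.unusedSectionVars false
section
variable {F : Type} [Field F] [Fintype F] {V : Type} [AddCommGroup V] [Module F V] [Finite V]

lemma slice_one {a : V →ₗ[F] F} {w : V} (hw : a w = 1) {f : V → F} (hf0 : f ≠ 0) {c : F}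
    (hc : ∀ x, f x ≠ 0 → a x = c) {r : ℕ} (hf : f ∈ PD F V r) :
    sl a w f c ≠ 0 ∧ sl a w f c ∈ PD F (LinearMap.ker a) (r - (Fintype.card F - 1)) ∧
    NZ (sl a w f c) = NZ f := by
  have hq : 1 < Fintype.card F := Fintype.one_lt_card
  have hh : hit a f = {c} := by
    ext d
    rw [mem_hit, Finset.mem_singleton]
    constructor
    · rintro ⟨x, hx, rfl⟩; exact hc x hx
    · rintro rfl
      obtain ⟨x, hx⟩ := Function.ne_iff.mp hf0
      exact ⟨x, hx, hc x hx⟩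
  have hm : c ∈ hit a f := by simp [hh]
  refine ⟨sl_ne_zero a w hw f hm, ?_, ?_⟩
  · have := (sl_PD a w hw hf hm).2
    rw [hh] at this
    convert this using 2
    simp; omega
  · rw [NZ_eq_sum a w hw f, hh]; simp

lemma lift_slice (a : V →ₗ[F] F) (w : V) (f : V → F) (c : F) 
    (D : Submodule F (LinearMap.ker a)) (p : LinearMap.ker a) :
    {k | sl a w f c k ≠ 0 ∧ k - p ∈ D}.ncard ≤ 
      {x | f x ≠ 0 ∧ x - (p + c • w) ∈ D.map (LinearMap.ker a).subtype}.ncard := by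
  rw [← Set.ncard_image_of_injective (f := fun k : LinearMap.ker a => (k:V) + c • w)]
  · apply Set.ncard_le_ncard _ (Set.toFinite _)
    rintro _ ⟨k, ⟨h1, h2⟩, rfl⟩
    refine ⟨h1, ?_⟩
    exact ⟨k - p, h2, by simp⟩
  · intro k k' h
    simpa using h

lemma hyper_of_sub {D : Submodule F V} (hD : Module.finrank F D < Module.finrank F V) (p : V) :
    ∃ (a : V →ₗ[F] F) (c : F), a ≠ 0 ∧ ∀ x, x - p ∈ D → a x = c := by
  obtain ⟨a, ha, h⟩ := Submodule.exists_le_ker_of_lt_top D (by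
    rw [lt_top_iff_ne_top]
    rintro rfl
    simp at hD)
  refine ⟨a, a p, ha, fun x hx => ?_⟩
  have := h hx
  simpa [sub_eq_zero] using this

lemma vlem (S : Set V) {p : V} (hp : p ∈ S) 
    (h : (Fintype.card F - 1) * (S.ncard - 1) < Fintype.card F ^ Module.finrank F V - 1) :
    ∃ v : V, v ≠ 0 ∧ ∀ c : F, c ≠ 0 → p + c • v ∉ S := by
  classical
  have := Fintype.ofFinite V
  by_contra! hcon
  let A := ((Finset.univ : Finset F).erase 0) ×ˢ (S.toFinset.erase p)
  have hsub : (Finset.univ : Finset V).erase 0 ⊆ A.image (fun y => y.1 • (y.2 - p)) := by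
    intro v hv
    simp only [Finset.mem_erase, Finset.mem_univ, and_true] at hv
    obtain ⟨c, hc, hs⟩ := hcon v hv
    rw [Finset.mem_image]
    refine ⟨(c⁻¹, p + c • v), ?_, ?_⟩
    · simp [A, hc, hs, hv]
    · simp [hc]
  have h1 := (Finset.card_le_card hsub).trans Finset.card_image_le
  rw [Finset.card_product, Finset.card_erase_of_mem (Finset.mem_univ _), Finset.card_erase_of_mem (Finset.mem_univ _), 
    Finset.card_erase_of_mem (by simpa using hp), Finset.card_univ, Finset.card_univ, ← Set.ncard_eq_toFinset_card', 
    ← Nat.card_eq_fintype_card, card_V (F := F)] at h1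
  omega

lemma vred {r : ℕ} {f : V → F} (hf : f ∈ PD F V (r + (Fintype.card F - 1))) (hf0 : f ≠ 0)
    (h : (Fintype.card F - 1) * (NZ f - 1) < Fintype.card F ^ Module.finrank F V - 1) :
    ∃ (a : V →ₗ[F] F) (v : V) (G : LinearMap.ker a → F), a v = 1 ∧ G ≠ 0 ∧ G ∈ PD F (LinearMap.ker a) r ∧
      NZ G ≤ NZ f ∧ ∀ (D : Submodule F (LinearMap.ker a)) (p : LinearMap.ker a), 
        {k | G k ≠ 0 ∧ k - p ∈ D}.ncard ≤ 
        {x | f x ≠ 0 ∧ x - p ∈ D.map (LinearMap.ker a).subtype ⊔ Submodule.span F {v}}.ncard := by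
  obtain ⟨p, hp⟩ := Function.ne_iff.mp hf0
  obtain ⟨v, hv, hvp⟩ := vlem {x | f x ≠ 0} (p := p) hp h
  obtain ⟨a, hav⟩ : ∃ a : V →ₗ[F] F, a v = 1 := by
    obtain ⟨g, hg⟩ : ∃ g : Module.Dual F V, g v ≠ 0 := by
      by_contra! h
      exact hv ((Module.forall_dual_apply_eq_zero_iff F v).1 h)
    exact ⟨(g v)⁻¹ • g, by simp [hg]⟩
  let G : LinearMap.ker a → F := fun k => ∑ c : F, f (k + c • v)
  have hpush := (PD_push hf v).1
  have hG : ∀ k, G k ≠ 0 → ∃ c : F, f (k + c • v) ≠ 0 := by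
    intro k hk
    by_contra! h
    exact hk (Finset.sum_eq_zero (fun c _ => h c))
  refine ⟨a, v, G, hav, ?_, ?_, ?_, ?_⟩
  · apply Function.ne_iff.2
    refine ⟨prj a v hav p, ?_⟩
    have : G (prj a v hav p) = f p := by
      show ∑ c : F, f (prj a v hav p + c • v) = f p
      rw [Finset.sum_eq_single (a p)]
      · simp [prj_coe]
      · intro c _ hc
        have := hvp (c - a p) (sub_ne_zero.2 hc)
        simp only [Set.mem_ofPred_eq, not_not] at this
        rw [prj_coe, ← this]
        congr 1
        rw [sub_smul]; abel
      · simp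
    rw [this]; exact hp
  · have := PD_comp hpush (slA a v 0)
    rw [Nat.add_sub_cancel] at this
    simpa [slA_apply] using this
  · unfold NZ
    calc _ ≤ ((prj a v hav) '' {x | f x ≠ 0}).ncard := by
          apply Set.ncard_le_ncard _ (Set.toFinite _)
          intro k hk
          obtain ⟨c, hc⟩ := hG k hk
          exact ⟨_, hc, prj_ker _ _ _ _ _⟩
      _ ≤ _ := Set.ncard_image_le (Set.toFinite _)
  · intro D p
    calc _ ≤ ((prj a v hav) '' {x | f x ≠ 0 ∧ x - p ∈ D.map (LinearMap.ker a).subtype ⊔ Submodule.span F {v}}).ncard := by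
          apply Set.ncard_le_ncard _ (Set.toFinite _)
          rintro k ⟨hk, hkD⟩
          obtain ⟨c, hc⟩ := hG k hk
          refine ⟨_, ⟨hc, ?_⟩, prj_ker _ _ _ _ _⟩
          rw [Submodule.mem_sup]
          refine ⟨k - p, ⟨k - p, hkD, by simp⟩, c • v, Submodule.smul_mem _ _ (Submodule.mem_span_singleton_self v), by abel⟩
      _ ≤ _ := Set.ncard_image_le (Set.toFinite _)

lemma L13 (hq3 : 3 ≤ Fintype.card F) (hn : 2 ≤ Module.finrank F V) {f : V → F} (hf0 : f ≠ 0)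
    (hf : f ∈ PD F V (Fintype.card F)) 
    (hN : NZ f ≤ (Fintype.card F - 1) * Fintype.card F ^ (Module.finrank F V - 2)) :
    ∃ (a : V →ₗ[F] F) (c : F), a ≠ 0 ∧ ∀ x, f x ≠ 0 → a x = c := by
  have hq : 1 < Fintype.card F := Fintype.one_lt_card
  obtain ⟨n, hn'⟩ := Nat.exists_eq_add_of_le' hn
  rw [hn'] at hN
  simp only [Nat.add_sub_cancel] at hN
  set q := Fintype.card F with hqd
  obtain ⟨a, w, c, hw, hlow⟩ := exists_low' hf0 (by 
    rw [hn', pow_add]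
    refine lt_of_le_of_lt hN ?_
    rw [← hqd, mul_comm]
    apply Nat.mul_lt_mul_of_pos_left (by nlinarith [Nat.sub_le q 1]) (by positivity))
  rw [← hqd] at hlow
  have ha := ne_of_w hw
  have hK := finrank_ker' ha
  have hd' := fun c (hc : c ∈ hit a f) => sl_PD a w hw hf hc
  have hn0 := fun c (hc : c ∈ hit a f) => sl_ne_zero a w hw f hc
  have hS := NZ_eq_sum a w hw f
  obtain ⟨c0, hc0⟩ := hit_nonempty a hf0
  have hj1 : 1 ≤ (hit a f).card := Finset.card_pos.2 ⟨c0, hc0⟩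
  have hjq := hit_le a f
  by_cases hone : (hit a f).card = 1 
  · obtain ⟨c, hc⟩ := hit_one hone
    exact ⟨a, c, ha, hc⟩
  set j := (hit a f).card with hj
  have hjlt : j < q := by
    by_contra h
    have hm := hit_univ (not_lt.1 h)
    rcases n with _ | n
    · have := NZ_pos (hn0 c (hm c))
      have h1 : ∀ c ∈ hit a f, 1 ≤ NZ (sl a w f c) := fun c hc => NZ_pos (hn0 c hc)
      have h2 := Finset.card_nsmul_le_sum _ _ _ h1
      rw [← hS] at h2
      simp only [smul_eq_mul, ← hj] at h2
      simp at hN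
      omega
    · have := minwt (n+2) (LinearMap.ker a) (by omega) 1 1 (sl a w f c) (by omega) (by omega) (hn0 c (hm c)) (by convert (hd' c (hm c)).2 using 2; omega)
      rw [show n + 2 - 1 - 1 = n by omega] at this
      have h3 := Nat.mul_le_mul_left q this
      rw [← hqd] at h3
      have h4 : q * ((q - 1) * q ^ n) = (q - 1) * q ^ (n+1) := by ring
      omega
  have hw' : ∀ c ∈ hit a f, (q - j) * q ^ n ≤ NZ (sl a w f c) := by
    intro c hc
    have := minwt (n+1) (LinearMap.ker a) (by omega) 0 j (sl a w f c) (by omega) (by omega) (hn0 c hc) (by convert (hd' c hc).2 using 2; omega)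
    simpa using this
  have hsum := Finset.card_nsmul_le_sum _ _ _ hw'
  rw [← hS, smul_eq_mul, ← hj] at hsum
  have hpn : 0 < q ^ n := by positivity
  have hnum : j * (q - j) ≤ q - 1 := by
    apply Nat.le_of_mul_le_mul_right _ hpn
    calc _ = j * ((q - j) * q ^ n) := by ring
      _ ≤ _ := hsum
      _ ≤ _ := hN
  have hjq1 : j = q - 1 := by
    obtain ⟨s, hs⟩ := Nat.exists_eq_add_of_lt hjlt
    obtain ⟨y, hy⟩ := Nat.exists_eq_add_of_le' hj1
    have e1 : q - j = s + 1 := by omega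
    have e2 : q - 1 = y + s + 1 := by omega
    rw [e1, e2, hy] at hnum
    have : y * s ≤ 0 := by nlinarith
    have : s = 0 := by
      by_contra h
      have : 0 < y * s := Nat.mul_pos (by omega) (by omega)
      omega
    omega
  have e1 : q - j = 1 := by omega
  rw [e1, one_mul] at hw'
  have hexact : ∀ c ∈ hit a f, NZ (sl a w f c) = q ^ n := by
    by_contra! h
    obtain ⟨c1, hc1, hc1'⟩ := h
    have : ∑ c ∈ hit a f, q ^ n < ∑ c ∈ hit a f, NZ (sl a w f c) := 
      Finset.sum_lt_sum hw' ⟨c1, hc1, lt_of_le_of_ne (hw' c1 hc1) (Ne.symm hc1')⟩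
    rw [← hS, Finset.sum_const, smul_eq_mul, ← hj, hjq1] at this
    omega
  obtain ⟨c2, hc2, hc20⟩ : ∃ c2 ∈ hit a f, c2 ≠ c0 := by
    apply Finset.exists_mem_ne
    omega
  obtain ⟨b, e, hb, hbe⟩ := L12 (F := F) (V := LinearMap.ker a) (by omega) (hn0 c0 hc0) 
    (by convert (hd' c0 hc0).2 using 2; omega) (by rw [hexact c0 hc0]; apply le_of_eq; congr 1; omega)
  obtain ⟨p, hp, hpc⟩ := (mem_hit _ _ _).1 hc2
  let B := b ∘ₗ prj a w hw
  let μ := (e - B p) / (c2 - c0)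
  let L : V →ₗ[F] F := B + μ • a
  let C := e + μ * c0
  have hL : L ≠ 0 := by
    intro h
    apply hb
    ext k
    have := DFunLike.congr_fun h (k : V)
    have h2 := prj_ker a w hw k 0
    simp only [zero_smul, add_zero] at h2
    simpa [L, B, h2] using this
  refine ⟨L, C, hL, ?_⟩
  by_contra! hcon
  obtain ⟨z, hz, hzC⟩ := hcon
  have hcut := cut_card f L C
  have hmw := minwt (n+2) V hn' 1 2 (fun x => f x * lmc L C x) (by omega) (by omega) 
    (Function.ne_iff.2 ⟨z, by simp [lmc_apply, hz, sub_ne_zero, hzC]⟩)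
    (by convert cut_PD hf L C using 2; omega)
  have hsub : insert p {x | f x ≠ 0 ∧ a x = c0} ⊆ {x | f x ≠ 0 ∧ L x = C} := by
    intro x hx
    rcases hx with rfl | ⟨h1, h2⟩
    · refine ⟨hp, ?_⟩
      have : c2 - c0 ≠ 0 := sub_ne_zero.2 hc20
      simp only [L, C, μ, LinearMap.add_apply, LinearMap.smul_apply, hpc, smul_eq_mul]
      field_simp
      ring
    · refine ⟨h1, ?_⟩
      have h3 := hbe (prj a w hw x) (by simpa [sl, prj_coe, h2] using h1)
      simp [L, C, B, h2, h3]
  have h5 := Set.ncard_le_ncard hsub (Set.toFinite _)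
  rw [Set.ncard_insert_of_notMem, ← sl_card a w hw, hexact c0 hc0] at h5
  · rw [show n + 2 - 1 - 1 = n by omega, ← hqd] at hmw
    have : (q - 2) * q ^ n + q ^ n = (q - 1) * q ^ n := by
      rw [← Nat.succ_mul]; congr 1; omega
    omega
  · rintro ⟨_, h⟩
    exact hc20 (hpc.symm.trans h)

lemma finrank_sup_span (D : Submodule F V) (v : V) :
    Module.finrank F (D ⊔ Submodule.span F {v} : Submodule F V) ≤ Module.finrank F D + 1 := by
  have h := Submodule.finrank_sup_add_finrank_inf_eq D (Submodule.span F {v})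
  have h2 : Module.finrank F (Submodule.span F {v}) ≤ 1 := by
    have := finrank_span_le_card (R := F) ({v} : Set V)
    simpa using this
  omega

lemma finrank_map_sub {K : Submodule F V} (D : Submodule F K) :
    Module.finrank F (D.map K.subtype) = Module.finrank F D := 
  Submodule.finrank_map_subtype_eq K D

lemma all_of_card {f : V → F} {P : V → Prop} (h : NZ f ≤ {x | f x ≠ 0 ∧ P x}.ncard) : ∀ x, f x ≠ 0 → P x := by
  intro x hx
  have : {x | f x ≠ 0 ∧ P x} = {x | f x ≠ 0} := Set.eq_of_subset_of_ncard_le (fun y hy => hy.1) h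
  have h2 : x ∈ {x | f x ≠ 0 ∧ P x} := by rw [this]; exact hx
  exact h2.2

lemma L14 (hq3 : 3 ≤ Fintype.card F) {k : ℕ} (hk : 1 ≤ k) (t : ℕ) : ∀ (V : Type) [AddCommGroup V] [Module F V] [Finite V],
    Module.finrank F V = (t + 1) + k → ∀ f : V → F, f ≠ 0 → f ∈ PD F V ((t+1) * (Fintype.card F - 1) + 1) →
    NZ f ≤ (Fintype.card F - 1) * Fintype.card F ^ (k - 1) → 
    ∃ (p : V) (D : Submodule F V), Module.finrank F D ≤ k ∧ 
      (Fintype.card F - 1) * Fintype.card F ^ (k - 1) ≤ {x | f x ≠ 0 ∧ x - p ∈ D}.ncard := by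
  induction t with
  | zero =>
    intro V _ _ _ hV f hf0 hf hN
    obtain ⟨a, c, ha, hac⟩ := L13 hq3 (by omega) hf0 (by convert hf using 2; omega) 
      (by convert hN using 3; omega)
    obtain ⟨w, hw⟩ := exists_w ha
    refine ⟨c • w, LinearMap.ker a, ?_, ?_⟩
    · have := finrank_ker' ha; omega
    · have h1 := minwt (1 + k) V (by omega) 1 1 f (by omega) (by omega) hf0 (by simpa using hf)
      have e : {x | f x ≠ 0 ∧ x - c • w ∈ LinearMap.ker a} = {x | f x ≠ 0} := by
        ext x
        simp only [Set.mem_ofPred_eq, and_iff_left_iff_imp]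
        intro hx
        simp [hw, hac x hx]
      rw [e, show k - 1 = 1 + k - 1 - 1 by omega]
      exact h1
  | succ t ih =>
    intro V _ _ _ hV f hf0 hf hN
    have hpos : 0 < Fintype.card F ^ (k-1) := by positivity
    obtain ⟨a, v, G, hav, hG0, hG, hGN, hGD⟩ := vred (r := (t+1) * (Fintype.card F - 1) + 1) (f := f) 
      (by convert hf using 2; ring) hf0 (by
        rw [hV]
        set q := Fintype.card F
        obtain ⟨u, hu⟩ := Nat.exists_eq_add_of_le' hq3
        have e : t + 1 + 1 + k = (k - 1) + 3 + t := by omega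
        have h1 : q ^ (k - 1 + 3) ≤ q ^ (t + 1 + 1 + k) := Nat.pow_le_pow_right (by omega) (by omega)
        have h2 : (q - 1) * (NZ f - 1) ≤ (q - 1) * ((q - 1) * q ^ (k-1)) := Nat.mul_le_mul_left _ (by omega)
        have h3 : (q - 1) * ((q - 1) * q ^ (k-1)) + 1 < q ^ (k - 1 + 3) := by
          rw [show q - 1 = u + 2 by omega, pow_add]
          generalize q ^ (k-1) = X at *
          rw [hu]
          nlinarith [Nat.zero_le (u^3), Nat.zero_le (u^2), Nat.zero_le u, Nat.zero_le (X*u), Nat.zero_le (X*u^2), Nat.zero_le (X*u^3)]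
        omega)
    have hK := finrank_ker' (ne_of_w hav)
    obtain ⟨p, D, hD, hDc⟩ := ih (LinearMap.ker a) (by omega) G hG0 hG (hGN.trans hN)
    have h1 := (hN.trans hDc).trans (hGD D p)
    have h2 := all_of_card h1
    have h3 := finrank_sup_span (D.map (LinearMap.ker a).subtype) v
    rw [finrank_map_sub] at h3
    obtain ⟨b, c, hb, hbc⟩ := hyper_of_sub (F := F) (D := D.map (LinearMap.ker a).subtype ⊔ Submodule.span F {v}) (by omega) (p : V)
    obtain ⟨w, hw⟩ := exists_w hb
    have hK' := finrank_ker' hb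
    obtain ⟨s1, s2, s3⟩ := slice_one hw hf0 (fun x hx => hbc x (h2 x hx)) hf
    obtain ⟨p', D', hD', hDc'⟩ := ih (LinearMap.ker b) (by omega) _ s1 (by 
      convert s2 using 2
      have : (t + 1 + 1) * (Fintype.card F - 1) = (t+1) * (Fintype.card F - 1) + (Fintype.card F - 1) := by ring
      omega) (by omega)
    refine ⟨_, _, ?_, hDc'.trans (lift_slice b w f c D' p')⟩
    rw [finrank_map_sub]; exact hD'
end

set_option linter.unusedSectionVars false
section
variable {F : Type} [Field F] [Fintype F] {V : Type} [AddCommGroup V] [Module F V] [Finite V]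

lemma PD_div {r : ℕ} {f : V → F} (hf : f ∈ PD F V (r + 1)) (l : V →ᵃ[F] F) {w : V} (hw : l.linear w = 1)
    (h0 : ∀ x, l x = 0 → f x = 0) : ∃ g ∈ PD F V r, ∀ x, f x = l x * g x := by
  obtain ⟨g, hg, h⟩ := PD_split hf l (-w)
  refine ⟨-g, Submodule.neg_mem _ hg, fun x => ?_⟩
  have h1 := h x
  rw [h0 (x + l x • -w) (by rw [aff_shift]; simp [hw])] at h1
  simp only [Pi.neg_apply]
  linear_combination -h1

lemma PD_diff {r : ℕ} {f : V → F} (hf : f ∈ PD F V (r + 1)) (v : V) :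
    (fun x => f (x + v) - f x) ∈ PD F V r := by
  obtain ⟨g, hg, h⟩ := PD_split hf (AffineMap.const F V 1) v
  convert hg using 1
  funext x
  have := h x
  simp at this
  rw [this]; ring

lemma Zlem {ι : Type*} : ∀ (d : ℕ) (g : V → F) (s : Finset ι) (l : ι → (V →ᵃ[F] F)),
    g ∈ PD F V d → d + 2 ≤ Fintype.card F → d + 1 ≤ s.card → 
    (∀ i ∈ s, ∃ w, (l i).linear w = 1) → (∀ i ∈ s, ∀ j ∈ s, i ≠ j → ∃ x, l i x = 0 ∧ l j x ≠ 0) →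
    (∀ i ∈ s, ∀ x, l i x = 0 → g x = 0) → g = 0 := by
  classical
  intro d
  induction d with
  | zero =>
    intro g s l hg hq hs h1 h2 h3
    obtain ⟨i, hi⟩ := Finset.card_pos.1 (by omega : 0 < s.card)
    obtain ⟨c, hc⟩ := PD_zero hg
    obtain ⟨w, hw⟩ := h1 i hi
    have := h3 i hi (0 + (- l i 0) • w) (by rw [aff_shift, hw]; ring)
    rw [hc] at this
    funext x; rw [hc, this]; rfl
  | succ d ih =>
    intro g s l hg hq hs h1 h2 h3
    obtain ⟨i, hi⟩ := Finset.card_pos.1 (by omega : 0 < s.card)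
    obtain ⟨w, hw⟩ := h1 i hi
    obtain ⟨h, hh, hgh⟩ := PD_div hg (l i) hw (h3 i hi)
    have : h = 0 := by
      apply ih h (s.erase i) l hh (by omega) (by rw [Finset.card_erase_of_mem hi]; omega)
      · intro j hj; exact h1 j (Finset.mem_of_mem_erase hj)
      · intro j hj k hk; exact h2 j (Finset.mem_of_mem_erase hj) k (Finset.mem_of_mem_erase hk)
      · intro j hj x hx
        have hjs := Finset.mem_of_mem_erase hj
        by_cases hix : l i x = 0
        · obtain ⟨y, hy, hy'⟩ := h2 j hjs i hi (Finset.ne_of_mem_erase hj)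
          have hp := (PD_push hh (y - x)).2 (by omega) x
          have ey : ∀ l : V →ᵃ[F] F, l.linear (y - x) = l y - l x := by
            intro l; exact (l.linearMap_vsub y x)
          rw [Finset.sum_eq_single 0] at hp
          · simpa using hp
          · intro c _ hc
            have e1 : l j (x + c • (y - x)) = 0 := by rw [aff_shift, ey, hx, hy]; ring
            have e2 : l i (x + c • (y - x)) ≠ 0 := by 
              rw [aff_shift, ey, hix]; simp [hc, hy']
            have e3 := hgh (x + c • (y - x))
            rw [h3 j hjs _ e1] at e3
            have := mul_eq_zero.1 e3.symm
            tauto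
          · simp
        · have e3 := hgh x
          rw [h3 j hjs x hx] at e3
          have := mul_eq_zero.1 e3.symm
          tauto
    funext x; rw [hgh, this]; simp

lemma inv_card {f : V → F} {g : V →ₗ[F] F} {v : V} (hv : g v = 1) 
    (hinv : ∀ x (c : F), f (x + c • v) ≠ 0 ↔ f x ≠ 0) : NZ f = Fintype.card F * NZ (sl g v f 0) := by
  have h := card_hit_sum g {x | f x ≠ 0}
  rw [NZ, h, Finset.sum_const_nat (m := NZ (sl g v f 0))]
  · rfl
  · intro c _
    have : NZ (sl g v f c) = NZ (sl g v f 0) := by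
      unfold NZ
      congr 1
      ext k
      simp only [Set.mem_ofPred_eq, sl]
      rw [hinv, hinv]
    rw [← this, sl_card g v hv]; rfl

lemma sl_PD0 (a : V →ₗ[F] F) (w : V) {f : V → F} {r : ℕ} (hf : f ∈ PD F V r) (c : F) : 
    sl a w f c ∈ PD F (LinearMap.ker a) r := by
  have := PD_comp hf (slA a w c)
  convert this using 1
  funext k
  simp [slA_apply, sl]

lemma pencil (hq3 : 3 ≤ Fintype.card F) {m : ℕ} (hn : Module.finrank F V = m + 3) {f : V → F} 
    (hf : f ∈ PD F V (Fintype.card F - 1)) 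
    (hN : NZ f ≤ 2 * (Fintype.card F - 1) * Fintype.card F ^ (m + 1))
    (hcon : ∀ a : V →ₗ[F] F, a ≠ 0 → ∀ c, ∃ x, a x = c ∧ f x ≠ 0)
    (a b : V →ₗ[F] F) (w1 w2 : V) (h1 : a w1 = 1) (h2 : a w2 = 0) (h3 : b w1 = 0) (h4 : b w2 = 1)
    (c e : F) (hA : ∀ x, a x = c → b x = e → f x = 0) :
    ∃ μ c' u : F, c' ≠ c ∧ u ≠ 0 ∧ ∀ x, b x - μ * a x = e - μ * c → (f x ≠ 0 ↔ a x = c') ∧ (a x = c' → f x = u) := by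
  classical
  set q := Fintype.card F with hq
  by_contra! hbad
  have hbig : ∀ μ : F, 2 * (q - 1) * q ^ m ≤ {x | f x ≠ 0 ∧ b x - μ * a x = e - μ * c}.ncard := by
    intro μ
    let L : V →ₗ[F] F := b - μ • a
    have hL : L w2 = 1 := by simp [L, h2, h4]
    have hL0 := ne_of_w hL
    have hK := finrank_ker' hL0
    let g := sl L w2 f (e - μ * c)
    have hg : g ∈ PD F _ (q - 1) := sl_PD0 L w2 hf _
    have hgc : NZ g = {x | f x ≠ 0 ∧ b x - μ * a x = e - μ * c}.ncard := sl_card L w2 hL f _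
    have hg0 : g ≠ 0 := by
      obtain ⟨x, hx, hx'⟩ := hcon L hL0 (e - μ * c)
      exact sl_ne_zero L w2 hL f ((mem_hit _ _ _).2 ⟨x, hx', hx⟩)
    rw [← hgc]
    let a' : LinearMap.ker L →ₗ[F] F := a ∘ₗ (LinearMap.ker L).subtype
    let w' : LinearMap.ker L := ⟨w1 + μ • w2, by simp [L, h1, h2, h3, h4]⟩
    have hw' : a' w' = 1 := by simp [a', w', h1, h2]
    have ha' := ne_of_w hw'
    have hK' := finrank_ker' ha'
    obtain ⟨c0, hc0⟩ := hit_nonempty a' hg0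
    have hj1 : 1 ≤ (hit a' g).card := Finset.card_pos.2 ⟨c0, hc0⟩
    have hmiss : ∀ d ∈ hit a' g, d ≠ c := by
      rintro d hd rfl
      obtain ⟨k, hk, hkd⟩ := (mem_hit _ _ _).1 hd
      apply hk
      have hk0 : b k - μ * a k = 0 := k.2
      simp [a'] at hkd
      apply hA
      · simp [h2, hkd]
      · simp only [map_add, map_smul, h4, smul_eq_mul]
        rw [hkd] at hk0
        linear_combination hk0
    have hjlt : (hit a' g).card ≤ q - 1 := by
      have : hit a' g ⊆ Finset.univ.erase c := fun d hd => by simp [hmiss d hd]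
      have := Finset.card_le_card this
      rwa [Finset.card_erase_of_mem (Finset.mem_univ _), Finset.card_univ, ← hq] at this
    have hd' := fun c (hc : c ∈ hit a' g) => sl_PD a' w' hw' hg hc
    have hn0 := fun c (hc : c ∈ hit a' g) => sl_ne_zero a' w' hw' g hc
    have hS := NZ_eq_sum a' w' hw' g
    set j := (hit a' g).card with hj
    by_cases hone : j = 1
    · exfalso
      have h5 := (hd' c0 hc0).2
      rw [hone, ← hq, show q - 1 + 1 - q = 0 by omega] at h5
      obtain ⟨u, hu⟩ := PD_zero h5
      obtain ⟨c1, hc1⟩ := hit_one (hj.symm.trans hone)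
      have hc10 : c0 = c1 := by
        obtain ⟨k, hk, hkd⟩ := (mem_hit _ _ _).1 hc0
        rw [← hkd, hc1 k hk]
      subst hc10
      have hu0 : u ≠ 0 := by
        rintro rfl
        exact hn0 c0 hc0 (funext hu)
      have key : ∀ x, b x - μ * a x = e - μ * c → a x = c0 → f x = u := by
        intro x hx hxa
        have h6 := hu (prj a' w' hw' (prj L w2 hL x))
        rw [← h6]
        simp only [sl, g]
        congr 1
        rw [prj_coe]
        have : a' (prj L w2 hL x) = c0 := by
          simp [a', prj_coe, h2, hxa]
        rw [this, sub_add_cancel, prj_coe]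
        have : L x = e - μ * c := by simpa [L] using hx
        rw [this, sub_add_cancel]
      obtain ⟨x, hx, hx'⟩ := hbad μ c0 u (hmiss c0 hc0) hu0
      have hiff : f x ≠ 0 ↔ a x = c0 := by
        constructor
        · intro hfx
          have h7 := hc1 (prj L w2 hL x) (by
            have : L x = e - μ * c := by simpa [L] using hx
            simp only [g, sl, prj_coe, this, sub_add_cancel]; exact hfx)
          simpa [a', prj_coe, h2] using h7
        · intro h; rw [key x hx h]; exact hu0
      obtain ⟨h8, h9⟩ := hx' hiff
      exact h9 (key x hx h8)
    · have hw2 : ∀ c ∈ hit a' g, (q - (j - 1)) * q ^ m ≤ NZ (sl a' w' g c) := by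
        intro c hc
        have := minwt (m+1) (LinearMap.ker a') (by omega) 0 (j - 1) _ (by omega) (by omega) (hn0 c hc) (by convert (hd' c hc).2 using 2; omega)
        simpa using this
      have hsum := Finset.card_nsmul_le_sum _ _ _ hw2
      rw [← hS, smul_eq_mul, ← hj, ← mul_assoc] at hsum
      refine le_trans (Nat.mul_le_mul_right _ ?_) hsum
      obtain ⟨s, hs⟩ := Nat.exists_eq_add_of_le hjlt
      obtain ⟨y, hy⟩ := Nat.exists_eq_add_of_le' (show 2 ≤ j by omega)
      rw [show q - (j - 1) = s + 2 by omega, hs, hy]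
      nlinarith
  -- counting
  have hdis : ∑ μ : F, {x | f x ≠ 0 ∧ b x - μ * a x = e - μ * c}.ncard + {x | f x ≠ 0 ∧ a x = c}.ncard ≤ NZ f := by
    have := Fintype.ofFinite V
    have e1 : ∀ μ : F, {x | f x ≠ 0 ∧ b x - μ * a x = e - μ * c}.ncard = 
       ((Finset.univ.filter (fun x => f x ≠ 0 ∧ a x ≠ c)).filter (fun x => (b x - e) / (a x - c) = μ)).card := by
      intro μ
      rw [Set.ncard_eq_toFinset_card']
      congr 1
      ext x
      simp only [Set.mem_toFinset, Set.mem_ofPred_eq, Finset.mem_filter, Finset.mem_univ, true_and]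
      constructor
      · rintro ⟨hx, hx'⟩
        have hne : a x ≠ c := by
          intro h
          apply hx
          apply hA x h
          rw [h] at hx'
          linear_combination hx'
        refine ⟨⟨hx, hne⟩, ?_⟩
        have := sub_ne_zero.2 hne
        field_simp
        linear_combination hx'
      · rintro ⟨⟨hx, hne⟩, h⟩
        refine ⟨hx, ?_⟩
        have := sub_ne_zero.2 hne
        field_simp at h
        linear_combination h
    simp_rw [e1]
    rw [← Finset.card_eq_sum_card_fiberwise (f := fun x => (b x - e) / (a x - c)) (s := Finset.univ.filter (fun x => f x ≠ 0 ∧ a x ≠ c)) (t := Finset.univ) (by intro; simp), ← Set.ncard_coe_finset, ← Set.ncard_union_eq]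
    · apply Set.ncard_le_ncard _ (Set.toFinite _)
      intro x
      simp
      tauto
    · rw [Set.disjoint_left]
      intro x
      simp
      tauto
  have h5 := Finset.card_nsmul_le_sum (Finset.univ : Finset F) _ _ (fun μ _ => hbig μ)
  rw [Finset.card_univ, smul_eq_mul, ← hq] at h5
  obtain ⟨x, hx, hx'⟩ := hcon a (ne_of_w h1) c
  have h6 : 0 < {x | f x ≠ 0 ∧ a x = c}.ncard := (Set.ncard_pos (Set.toFinite _)).2 ⟨x, hx', hx⟩
  have : q * (2 * (q - 1) * q ^ m) = 2 * (q - 1) * q ^ (m+1) := by ring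
  omega

lemma Jamison (hn : Module.finrank F V = 2) {f : V → F} 
    (hN : NZ f ≤ 2 * (Fintype.card F - 1)) : ∃ (a : V →ₗ[F] F) (c : F), a ≠ 0 ∧ ∀ x, a x = c → f x = 0 := by
  classical
  have hq : 1 < Fintype.card F := Fintype.one_lt_card
  by_cases hf0 : f = 0
  · obtain ⟨a, ha⟩ := exists_dual (F := F) (V := V) (by omega)
    exact ⟨a, 0, ha, by simp [hf0]⟩
  obtain ⟨p, hp⟩ := Function.ne_iff.mp hf0
  have : Finite (Module.Dual F V) := Module.finite_of_finite F
  have := Fintype.ofFinite V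
  let s : Finset V := (Finset.univ.filter (fun x => f x ≠ 0)).erase p
  have hs : s.card + 1 ≤ 2 * (Fintype.card F - 1) := by
    have : NZ f = (Finset.univ.filter (fun x => f x ≠ 0)).card := by
      rw [NZ, Set.ncard_eq_toFinset_card']; congr 1; ext; simp
    rw [this] at hN
    rw [Finset.card_erase_of_mem (by simpa using hp)]
    have : 0 < (Finset.univ.filter (fun x => f x ≠ 0)).card := Finset.card_pos.2 ⟨p, by simpa using hp⟩
    omega
  let l : V → (Module.Dual F V →ᵃ[F] F) := fun x => AffineMap.const F _ 1 - (Module.Dual.eval F V (x - p)).toAffineMap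
  have hl : ∀ x a, l x a = 1 - a (x - p) := by intro x a; simp [l]
  have hP := PD_mono (show s.card ≤ 1 * (Fintype.card F - 1) + (Fintype.card F - 2) by omega) (PD_prod s l)
  have hmw := minwt 2 (Module.Dual F V) (by rw [Subspace.dual_finrank_eq, hn]) 1 _ _ (by omega) (by omega) (by
    apply Function.ne_iff.2
    exact ⟨0, by simp [hl]⟩) hP
  simp only [show 2 - 1 - 1 = 0 by rfl, pow_zero, mul_one] at hmw
  unfold NZ at hmw
  obtain ⟨a, ha, ha0⟩ := Set.exists_ne_of_one_lt_ncard (by omega : 1 < {x | (fun x => ∏ i ∈ s, (l i) x) x ≠ 0}.ncard) 0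
  refine ⟨a, a p + 1, ha0, ?_⟩
  intro x hx
  by_contra hfx
  have hxs : x ∈ s := by
    simp only [s, Finset.mem_erase, Finset.mem_filter, Finset.mem_univ, true_and]
    refine ⟨?_, hfx⟩
    rintro rfl
    simp at hx
  simp only [Set.mem_ofPred_eq, Finset.prod_ne_zero_iff] at ha
  apply ha x hxs
  rw [hl, map_sub, hx]; ring

lemma Mlem (hq3 : 3 ≤ Fintype.card F) (m : ℕ) : ∀ (V : Type) [AddCommGroup V] [Module F V] [Finite V],
    Module.finrank F V = m + 2 → ∀ f : V → F, f ∈ PD F V (Fintype.card F - 1) →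
    NZ f ≤ 2 * (Fintype.card F - 1) * Fintype.card F ^ m →
    ∃ (a : V →ₗ[F] F) (c : F), a ≠ 0 ∧ ∀ x, a x = c → f x = 0 := by
  classical
  induction m with
  | zero => 
    intro V _ _ _ hV f hf hN
    exact Jamison hV (by simpa using hN)
  | succ m ih =>
    intro V _ _ _ hV f hf hN
    by_contra! hcon
    have pen := pencil hq3 (m := m) hV hf hN (fun a ha c => hcon a c ha)
    obtain ⟨a0, ha0⟩ := exists_dual (F := F) (V := V) (by omega)
    obtain ⟨w, hw⟩ := exists_w ha0
    obtain ⟨c, hc⟩ : ∃ c, Fintype.card F * NZ (sl a0 w f c) ≤ NZ f := by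
      by_contra! h
      have h1 := card_hit_sum a0 {x | f x ≠ 0}
      have h2 : NZ f = ∑ c, NZ (sl a0 w f c) := by
        rw [NZ, h1]
        apply Finset.sum_congr rfl
        intro c _; rw [sl_card a0 w hw]; rfl
      have h3 : ∑ c : F, NZ f < ∑ c, Fintype.card F * NZ (sl a0 w f c) := 
        Finset.sum_lt_sum_of_nonempty ⟨0, Finset.mem_univ _⟩ (fun c _ => h c)
      rw [← Finset.mul_sum, ← h2] at h3
      simp at h3
    have hK := finrank_ker' ha0
    have hqpos : 0 < Fintype.card F := by omega
    obtain ⟨b0, e, hb0, hbe⟩ := ih (LinearMap.ker a0) (by omega) (sl a0 w f c) (sl_PD0 a0 w hf c) (by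
      apply Nat.le_of_mul_le_mul_left _ hqpos
      calc _ ≤ _ := hc
        _ ≤ _ := hN
        _ = _ := by ring)
    obtain ⟨w2, hw2⟩ := exists_w hb0
    let B := b0 ∘ₗ prj a0 w hw
    have hBk : ∀ k : LinearMap.ker a0, prj a0 w hw k = k := by
      intro k
      have := prj_ker a0 w hw k 0
      simpa using this
    have hw2a : a0 w2 = 0 := w2.2
    have hBw : B w = 0 := by
      have := prj_ker a0 w hw 0 1
      simp at this
      simp [B, this]
    have hBw2 : B w2 = 1 := by simp [B, hBk, hw2]
    obtain ⟨μ, e0, u0, he0, hu0, hgood⟩ := pen a0 B w w2 hw hw2a hBw hBw2 c e (by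
      intro x hx hx'
      have := hbe (prj a0 w hw x) hx'
      simpa [sl, prj_coe, hx] using this)
    -- rename
    let a : V →ₗ[F] F := B - μ • a0
    let d := e - μ * c
    have hga : ∀ x, a x = d → (f x ≠ 0 ↔ a0 x = e0) := by
      intro x hx
      exact (hgood x (by simpa [a] using hx)).1
    have haw2 : a w2 = 1 := by simp [a, hBw2, hw2a]
    have haw1 : a (w + μ • (w2:V)) = 0 := by simp [a, hBw, hBw2, hw2a, hw]
    have h0w1 : a0 (w + μ • (w2:V)) = 1 := by simp [hw2a, hw]
    have hall : ∀ e' : F, ∃ l : V →ᵃ[F] F, e' ≠ e0 → ((∃ z, l.linear z = 1) ∧ (∀ x, a x = d → l x = a0 x - e') ∧ 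
        ∀ x v, a v = 0 → a0 v = 0 → l x = 0 → f (x + v) = f x) := by
      intro e'
      by_cases he' : e' = e0
      · exact ⟨0, fun h => absurd he' h⟩
      obtain ⟨ν, c', u, hc', hu, hg⟩ := pen a a0 w2 (w + μ • (w2:V)) haw2 haw1 hw2a h0w1 d e' (by
        intro x hx hx'
        by_contra h
        have := (hga x hx).1 h
        exact he' (hx'.symm.trans this))
      have hl : ∀ x, lmc (a0 - ν • a) (e' - ν * d) x = (a0 x - ν * a x) - (e' - ν * d) := by
        intro x; simp [lmc_apply]
      refine ⟨lmc (a0 - ν • a) (e' - ν * d), fun _ => ⟨⟨w + μ • (w2:V), ?_⟩, ?_, ?_⟩⟩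
      · simp only [lmc, AffineMap.add_linear, AffineMap.const_linear, add_zero, LinearMap.toAffineMap_linear, LinearMap.sub_apply, LinearMap.smul_apply, haw1, h0w1]
        simp
      · intro x hx; rw [hl, hx]; ring
      · intro x v hv hv0 hx
        rw [hl, sub_eq_zero] at hx
        have g1 := hg x hx
        have g2 := hg (x + v) (by simpa [hv, hv0] using hx)
        have e3 : a (x + v) = a x := by simp [hv]
        rw [e3] at g2
        by_cases hxc : a x = c'
        · rw [g1.2 hxc, g2.2 hxc]
        · have := g1.1.not.2 hxc
          have := g2.1.not.2 hxc
          simp only [not_not] at *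
          rw [this, ‹f x = 0›]
    choose l hl using hall
    have hinv : ∀ v, a v = 0 → a0 v = 0 → ∀ x, f (x + v) = f x := by
      intro v hv hv0
      have hf' : f ∈ PD F V ((Fintype.card F - 2) + 1) := by convert hf using 2; omega
      have hz := Zlem (Fintype.card F - 2) _ (Finset.univ.erase e0) l (PD_diff hf' v) (by omega) 
        (by rw [Finset.card_erase_of_mem (Finset.mem_univ _), Finset.card_univ]; omega)
        (fun i hi => (hl i (Finset.ne_of_mem_erase hi)).1)
        (fun i hi j hj hij => by
          refine ⟨d • (w2:V) + i • (w + μ • (w2:V)), ?_, ?_⟩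
          · rw [(hl i (Finset.ne_of_mem_erase hi)).2.1]
            · simp only [map_add, map_smul, hw2a, hw, smul_eq_mul]; ring
            · rw [map_add, map_smul, map_smul, haw1, haw2]; simp
          · rw [(hl j (Finset.ne_of_mem_erase hj)).2.1]
            · simp only [map_add, map_smul, hw2a, hw, smul_eq_mul]
              intro h; apply hij; linear_combination h
            · rw [map_add, map_smul, map_smul, haw1, haw2]; simp)
        (fun i hi x hx => by
          rw [(hl i (Finset.ne_of_mem_erase hi)).2.2 x v hv hv0 hx, sub_self])
      intro x
      exact sub_eq_zero.1 (congrFun hz x)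
    obtain ⟨v, hv0, hva, hva0⟩ : ∃ v, v ≠ 0 ∧ a v = 0 ∧ a0 v = 0 := by
      have h1 : Module.finrank F (LinearMap.ker a0) = m + 2 := by omega
      have : LinearMap.ker (a ∘ₗ (LinearMap.ker a0).subtype) ≠ ⊥ := by
        apply LinearMap.ker_ne_bot_of_finrank_lt
        rw [h1]; simp
      obtain ⟨v, hv, hvne⟩ := Submodule.exists_mem_ne_zero_of_ne_bot this
      exact ⟨v, by simpa using hvne, by simpa using hv, v.2⟩
    obtain ⟨g, hg⟩ : ∃ g : V →ₗ[F] F, g v = 1 := by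
      obtain ⟨g, hg⟩ : ∃ g : Module.Dual F V, g v ≠ 0 := by
        by_contra! h
        exact hv0 ((Module.forall_dual_apply_eq_zero_iff F v).1 h)
      exact ⟨(g v)⁻¹ • g, by simp [hg]⟩
    have hinv' : ∀ x (c : F), f (x + c • v) = f x := fun x c => hinv (c • v) (by simp [hva]) (by simp [hva0]) x
    have hcard := inv_card hg (f := f) (fun x c => by rw [hinv'])
    have hKg := finrank_ker' (ne_of_w hg)
    obtain ⟨b', e', hb', hbe'⟩ := ih (LinearMap.ker g) (by omega) (sl g v f 0) (sl_PD0 g v hf 0) (by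
      apply Nat.le_of_mul_le_mul_left _ hqpos
      rw [← hcard]
      calc _ ≤ _ := hN
        _ = _ := by ring)
    obtain ⟨x, hx, hfx⟩ := hcon (b' ∘ₗ prj g v hg) e' (by
      intro h
      apply hb'
      ext k
      have h2 := DFunLike.congr_fun h (k : V)
      have h3 := prj_ker g v hg k 0
      simp only [zero_smul, add_zero] at h3
      simpa [h3] using h2)
    apply hfx
    have := hbe' (prj g v hg x) hx
    simp only [sl, prj_coe, zero_smul, add_zero] at this
    have h5 := hinv' (x - g x • v) (g x)
    rw [sub_add_cancel] at h5
    rw [h5, this]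
end

set_option linter.unusedSectionVars false
section
variable {F : Type} [Field F] [Fintype F] {V : Type} [AddCommGroup V] [Module F V] [Finite V]

/-- numeric consequence of the slice weights -/
lemma jnum {q j : ℕ} (h1 : 2 ≤ j) (h2 : j ≤ q - 1) (h : j * (q - (j - 1)) ≤ 2 * (q - 1)) :
    (j = 2 ∨ j = q - 1) ∧ j * (q - (j - 1)) = 2 * (q - 1) := by
  obtain ⟨s, hs⟩ := Nat.exists_eq_add_of_le h2
  obtain ⟨y, hy⟩ := Nat.exists_eq_add_of_le' h1
  rw [show q - (j - 1) = s + 2 by omega] at *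
  rw [hs, hy] at h ⊢
  have h3 : y * s ≤ 0 := by nlinarith
  have h4 : y * s = 0 := by omega
  refine ⟨?_, by nlinarith⟩
  rcases Nat.mul_eq_zero.1 h4 with h5 | h5
  · left; omega
  · right; omega

lemma hit_lt {a : V →ₗ[F] F} {f : V → F} {c : F} (h : ∀ x, a x = c → f x = 0) : 
    (hit a f).card ≤ Fintype.card F - 1 := by
  classical
  have : hit a f ⊆ Finset.univ.erase c := by
    intro d hd
    obtain ⟨x, hx, hxd⟩ := (mem_hit _ _ _).1 hd
    simp only [Finset.mem_erase, Finset.mem_univ, and_true]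
    rintro rfl
    exact hx (h x hxd)
  have := Finset.card_le_card this
  rwa [Finset.card_erase_of_mem (Finset.mem_univ _), Finset.card_univ] at this

/-- exact slice weights in the extremal case -/
lemma slices_exact {m : ℕ} (hV : Module.finrank F V = m + 2) {f : V → F} (hf0 : f ≠ 0) 
    (hf : f ∈ PD F V (Fintype.card F - 1)) 
    (hN : NZ f ≤ 2 * (Fintype.card F - 1) * Fintype.card F ^ m) {a : V →ₗ[F] F} {w : V} (hw : a w = 1) {c : F}
    (h : ∀ x, a x = c → f x = 0) :
    ((hit a f).card = 1 ∨ (hit a f).card = 2 ∨ (hit a f).card = Fintype.card F - 1) ∧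
    ∀ c ∈ hit a f, sl a w f c ∈ PD F (LinearMap.ker a) ((hit a f).card - 1) ∧
      NZ (sl a w f c) = (Fintype.card F - ((hit a f).card - 1)) * Fintype.card F ^ m := by
  have hq : 1 < Fintype.card F := Fintype.one_lt_card
  have hjlt := hit_lt h
  have hK := finrank_ker' (ne_of_w hw)
  have hd' := fun c (hc : c ∈ hit a f) => sl_PD a w hw hf hc
  have hn0 := fun c (hc : c ∈ hit a f) => sl_ne_zero a w hw f hc
  have hS := NZ_eq_sum a w hw f
  obtain ⟨c0, hc0⟩ := hit_nonempty a hf0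
  have hj1 : 1 ≤ (hit a f).card := Finset.card_pos.2 ⟨c0, hc0⟩
  set q := Fintype.card F with hqd
  set j := (hit a f).card with hj
  have hPD : ∀ c ∈ hit a f, sl a w f c ∈ PD F (LinearMap.ker a) (j - 1) := by
    intro c hc
    convert (hd' c hc).2 using 2
    omega
  have hw' : ∀ c ∈ hit a f, (q - (j - 1)) * q ^ m ≤ NZ (sl a w f c) := by
    intro c hc
    have := minwt (m+1) (LinearMap.ker a) (by omega) 0 (j - 1) (sl a w f c) (by omega) (by omega) (hn0 c hc) (by simpa using hPD c hc)
    simpa using this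
  by_cases hone : j = 1
  · refine ⟨Or.inl hone, fun c hc => ⟨hPD c hc, le_antisymm ?_ (hw' c hc)⟩⟩
    have := NZ_le (sl a w f c)
    rw [hone]
    rw [show Module.finrank F (LinearMap.ker a) = m + 1 by omega, ← hqd] at this
    rw [show q - (1 - 1) = q by omega, ← pow_succ']
    exact this
  have hsum := Finset.card_nsmul_le_sum _ _ _ hw'
  rw [← hS, smul_eq_mul, ← hj] at hsum
  have hnum : j * (q - (j - 1)) ≤ 2 * (q - 1) := by
    have : 0 < q ^ m := by positivity
    apply Nat.le_of_mul_le_mul_right _ this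
    calc _ = j * ((q - (j - 1)) * q ^ m) := by ring
      _ ≤ _ := hsum
      _ ≤ _ := hN
  obtain ⟨h1, h2⟩ := jnum (by omega) hjlt hnum
  refine ⟨Or.inr h1, fun c hc => ⟨hPD c hc, ?_⟩⟩
  by_contra hne
  have : ∑ c ∈ hit a f, (q - (j - 1)) * q ^ m < ∑ c ∈ hit a f, NZ (sl a w f c) := 
    Finset.sum_lt_sum hw' ⟨c, hc, lt_of_le_of_ne (hw' c hc) (Ne.symm hne)⟩
  rw [← hS, Finset.sum_const, smul_eq_mul, ← hj, ← mul_assoc, h2] at this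
  omega

lemma exists_dual_one {v : V} (hv : v ≠ 0) : ∃ g : V →ₗ[F] F, g v = 1 := by
  obtain ⟨g, hg⟩ : ∃ g : Module.Dual F V, g v ≠ 0 := by
    by_contra! h
    exact hv ((Module.forall_dual_apply_eq_zero_iff F v).1 h)
  exact ⟨(g v)⁻¹ • g, by simp [hg]⟩

lemma Vlem (hq3 : 3 ≤ Fintype.card F) {m : ℕ} (hV : Module.finrank F V = m + 3) {f : V → F} (hf0 : f ≠ 0) 
    (hf : f ∈ PD F V (Fintype.card F - 1)) 
    (hN : NZ f ≤ 2 * (Fintype.card F - 1) * Fintype.card F ^ (m + 1)) :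
    ∃ v : V, v ≠ 0 ∧ ∀ x (c : F), f (x + c • v) ≠ 0 ↔ f x ≠ 0 := by
  classical
  obtain ⟨a, cm, ha, hcm⟩ := Mlem hq3 (m+1) V hV f hf hN
  obtain ⟨w, hw⟩ := exists_w ha
  have hjlt := hit_lt hcm
  have hK := finrank_ker' ha
  obtain ⟨hj, hsl⟩ := slices_exact (m := m + 1) hV hf0 hf hN hw hcm
  obtain ⟨c0, hc0⟩ := hit_nonempty a hf0
  have hj1 : 1 ≤ (hit a f).card := Finset.card_pos.2 ⟨c0, hc0⟩
  have hb : ∀ c, ∃ (b : LinearMap.ker a →ₗ[F] F) (J : Finset F), c ∈ hit a f → (b ≠ 0 ∧ 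
      J.card = Fintype.card F - ((hit a f).card - 1) ∧ ∀ k, sl a w f c k ≠ 0 ↔ b k ∈ J) := by
    intro c
    by_cases hc : c ∈ hit a f
    · obtain ⟨b, J, h⟩ := L11 (F := F) (V := LinearMap.ker a) (d := (hit a f).card - 1) (by omega) (by omega) (hsl c hc).1 
        (by rw [(hsl c hc).2]; congr 2; omega)
      exact ⟨b, J, fun _ => h⟩
    · exact ⟨0, ∅, fun h => absurd h hc⟩
  choose b J hbJ using hb
  obtain ⟨v, hv, hv0⟩ : ∃ v ∈ LinearMap.ker (b c0), v ≠ 0 := by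
    apply Submodule.exists_mem_ne_zero_of_ne_bot
    apply LinearMap.ker_ne_bot_of_finrank_lt
    simp; omega
  have hv' : b c0 v = 0 := hv
  have hall : ∀ c ∈ hit a f, b c v = 0 := by
    intro c hc
    by_cases hcc : c = c0
    · rw [hcc]; exact hv'
    by_contra hbv
    have hj2 : 2 ≤ (hit a f).card := Finset.one_lt_card.2 ⟨c, hc, c0, hc0, hcc⟩
    let T := ((hit a f).erase c0).erase c
    have hT : T.card = (hit a f).card - 2 := by
      rw [Finset.card_erase_of_mem (by simp [hc, hcc]), Finset.card_erase_of_mem hc0]; omega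
    have hcomb := (sl_comb a w hw hf T).1
    rw [hT, show Fintype.card F - 1 + ((hit a f).card - 2) - (Fintype.card F - 1) = (hit a f).card - 2 by omega] at hcomb
    obtain ⟨_, hJ0, hiff0⟩ := hbJ c0 hc0
    obtain ⟨_, hJ, hiff⟩ := hbJ c hc
    obtain ⟨w0, hw0⟩ := exists_w (hbJ c0 hc0).1
    obtain ⟨y0, hy0⟩ : ∃ y0, y0 ∉ J c0 := by
      by_contra! h
      have : J c0 = Finset.univ := Finset.eq_univ_iff_forall.2 h
      rw [this, Finset.card_univ] at hJ0
      omega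
    let y := y0 • w0
    have hy : b c0 y = y0 := by simp [y, hw0]
    have hline : ∀ l : F, sl a w f c0 (y + l • v) = 0 := by
      intro l
      by_contra h
      have := (hiff0 _).1 h
      simp [hv', hy] at this
      exact hy0 this
    let A : F →ᵃ[F] LinearMap.ker a := (LinearMap.toSpanSingleton F _ v).toAffineMap + AffineMap.const F _ y
    have hA : ∀ l, A l = y + l • v := by intro l; simp [A, add_comm]
    have hh := PD_comp hcomb A
    have hval : ∀ l : F, ∑ d : F, sl a w f d (A l) * ∏ c' ∈ T, (d - c') = sl a w f c (A l) * ∏ c' ∈ T, (c - c') := by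
      intro l
      apply Finset.sum_eq_single c
      · intro d _ hd
        by_cases hdh : d ∈ hit a f
        · by_cases hd0 : d = c0
          · rw [hd0, hA, hline]; simp
          · rw [Finset.prod_eq_zero (i := d)]
            · simp
            · simp [T, hd, hdh, hd0]
            · simp
        · have : sl a w f d (A l) = 0 := by
            by_contra h
            apply hdh
            rw [mem_hit]
            exact ⟨_, h, by simp [hw]⟩
          simp [this]
      · simp
    simp_rw [hval] at hh
    have hC0 : ∏ c' ∈ T, (c - c') ≠ 0 := by
      rw [Finset.prod_ne_zero_iff]
      intro c' hc' h
      rw [sub_eq_zero] at h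
      simp [T, h] at hc'
    have hset : {l : F | sl a w f c (A l) * ∏ c' ∈ T, (c - c') ≠ 0} = (fun l => b c y + l * b c v) ⁻¹' (J c : Set F) := by
      ext l
      simp only [Set.mem_ofPred_eq, Set.mem_preimage, Finset.mem_coe, mul_ne_zero_iff, hC0, ne_eq, not_false_eq_true, and_true]
      have := hiff (A l)
      rw [hA] at this
      simpa [hA] using this
    have hcard : NZ (fun l : F => sl a w f c (A l) * ∏ c' ∈ T, (c - c')) = (J c).card := by
      unfold NZ
      rw [hset, ← Set.ncard_coe_finset]
      apply Set.ncard_preimage_of_injective_subset_range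
      · intro l l' h
        simpa [hbv] using h
      · intro z _
        exact ⟨(z - b c y) / b c v, by field_simp; ring⟩
    have hne : (fun l : F => sl a w f c (A l) * ∏ c' ∈ T, (c - c')) ≠ 0 := by
      intro h
      rw [h] at hcard
      simp [NZ] at hcard
      omega
    have hmw := minwt (F := F) 1 F (by simp) 0 ((hit a f).card - 2) _ (by omega) (by omega) hne (by simpa using hh)
    rw [hcard] at hmw
    simp at hmw
    omega
  have one : ∀ x (c : F), f x ≠ 0 → f (x + c • (v:V)) ≠ 0 := by
    intro x c hx
    have hh : a x ∈ hit a f := (mem_hit _ _ _).2 ⟨x, hx, rfl⟩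
    obtain ⟨_, _, hiff⟩ := hbJ _ hh
    have h1 := hiff (prj a w hw x)
    have h2 := hiff (prj a w hw x + c • v)
    rw [map_add, map_smul, hall _ hh, smul_zero, add_zero, ← h1] at h2
    have e1 : sl a w f (a x) (prj a w hw x) = f x := by simp [sl, prj_coe]
    have e2 : sl a w f (a x) (prj a w hw x + c • v) = f (x + c • (v:V)) := by 
      simp only [sl, prj_coe, Submodule.coe_add, Submodule.coe_smul]
      congr 1; abel
    rw [e1, e2] at h2
    exact h2.2 hx
  refine ⟨v, by simpa using hv0, fun x c => ⟨fun h => ?_, one x c⟩⟩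
  have := one _ (-c) h
  simpa using this

/-- independent affine functions -/
def Ind (a b : V →ᵃ[F] F) : Prop := ∃ w1 w2, a.linear w1 = 1 ∧ a.linear w2 = 0 ∧ b.linear w1 = 0 ∧ b.linear w2 = 1

/-- structure of the support for `t = 1` -/
def St1 (F : Type) [Field F] {V : Type} [AddCommGroup V] [Module F V] (S : V → Prop) : Prop := 
  (∃ a : V →ᵃ[F] F, (∃ w, a.linear w = 1) ∧ ∀ x, S x ↔ a x = 0) ∨ 
  (∃ a b : V →ᵃ[F] F, Ind a b ∧ ∀ x, S x ↔ (a x = 0 ∨ a x = 1) ∧ b x ≠ 0) ∨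
  (∃ a b : V →ᵃ[F] F, Ind a b ∧ ∀ x, S x ↔ (a x = 0 ∧ b x ≠ 0) ∨ (a x ≠ 0 ∧ b x = 0))

lemma Ind_comp {W : Type} [AddCommGroup W] [Module F W] {a b : W →ᵃ[F] F} (h : Ind a b) (A : V →ᵃ[F] W) 
    (hA : Function.Surjective A.linear) : Ind (a.comp A) (b.comp A) := by
  obtain ⟨w1, w2, h⟩ := h
  obtain ⟨v1, rfl⟩ := hA w1
  obtain ⟨v2, rfl⟩ := hA w2
  exact ⟨v1, v2, h⟩

lemma St1_comp {W : Type} [AddCommGroup W] [Module F W] {S : W → Prop} (h : St1 F S) (A : V →ᵃ[F] W) 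
    (hA : Function.Surjective A.linear) : St1 F (fun x => S (A x)) := by
  rcases h with ⟨a, ⟨w, hw⟩, h⟩ | ⟨a, b, hi, h⟩ | ⟨a, b, hi, h⟩
  · left
    obtain ⟨v, rfl⟩ := hA w
    exact ⟨a.comp A, ⟨v, hw⟩, fun x => h (A x)⟩
  · right; left
    exact ⟨_, _, Ind_comp hi A hA, fun x => h (A x)⟩
  · right; right
    exact ⟨_, _, Ind_comp hi A hA, fun x => h (A x)⟩
end

set_option linter.unusedSectionVars false
section
variable {F : Type} [Field F] [Fintype F]

/-- the affine function `r x + s y + t` on the plane -/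
noncomputable def af (r s t : F) : (F × F) →ᵃ[F] F := 
  (r • LinearMap.fst F F F + s • LinearMap.snd F F F).toAffineMap + AffineMap.const F _ t

lemma af_apply (r s t : F) (p : F × F) : af r s t p = r * p.1 + s * p.2 + t := by simp [af]

lemma af_lin (r s t : F) (p : F × F) : (af r s t).linear p = r * p.1 + s * p.2 := by simp [af]

lemma zeros1 {g : F → F} {d : ℕ} (hd : d ≤ Fintype.card F - 1) (hg : g ∈ PD F F d) (Z : Finset F) (hZ : d < Z.card) 
    (h : ∀ x ∈ Z, g x = 0) : ∀ x, g x = 0 := by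
  classical
  by_contra hne
  have hg0 : g ≠ 0 := by rintro rfl; exact hne (fun _ => rfl)
  have := minwt (F := F) 1 F (by simp) 0 d g hd (by omega) hg0 (by simpa using hg)
  have h2 : NZ g ≤ (Zᶜ : Finset F).card := by
    rw [NZ, ← Set.ncard_coe_finset]
    apply Set.ncard_le_ncard _ (Set.toFinite _)
    intro x hx
    simp only [Finset.coe_compl, Set.mem_compl_iff, Finset.mem_coe]
    exact fun hxZ => hx (h x hxZ)
  rw [Finset.card_compl] at h2
  have := Finset.card_le_univ Z
  simp at *
  omega

lemma push2 {f h : F × F → F} {i : ℕ} (hf : f ∈ PD F (F × F) (Fintype.card F - 1)) (hh : h ∈ PD F (F × F) i) :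
    (fun x => ∑ y, f (x, y) * h (x, y)) ∈ PD F F i := by
  have h1 := (PD_push (PD_mul hf hh) ((0, 1) : F × F)).1
  rw [show Fintype.card F - 1 + i - (Fintype.card F - 1) = i by omega] at h1
  have h2 := PD_comp h1 (LinearMap.inl F F F).toAffineMap
  simpa using h2

lemma cols {f : F × F → F} (hf0 : f ≠ 0) (hf : f ∈ PD F (F × F) (Fintype.card F - 1)) 
    (hN : NZ f ≤ 2 * (Fintype.card F - 1)) (hz : ∀ y, f (0, y) = 0) :
    ((hit (LinearMap.fst F F F) f).card = 1 ∨ (hit (LinearMap.fst F F F) f).card = 2 ∨ 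
      (hit (LinearMap.fst F F F) f).card = Fintype.card F - 1) ∧
    ∀ c ∈ hit (LinearMap.fst F F F) f, (fun y => f (c, y)) ∈ PD F F ((hit (LinearMap.fst F F F) f).card - 1) ∧
      {y | f (c, y) ≠ 0}.ncard = (Fintype.card F - ((hit (LinearMap.fst F F F) f).card - 1)) := by
  obtain ⟨h1, h2⟩ := slices_exact (F := F) (V := F × F) (m := 0) (by simp) hf0 hf (by simpa using hN) 
    (a := LinearMap.fst F F F) (w := (1, 0)) (by simp) (c := 0) (by rintro ⟨x, y⟩ h; simp at h; rw [h]; exact hz y)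
  refine ⟨h1, fun c hc => ?_⟩
  obtain ⟨h3, h4⟩ := h2 c hc
  constructor
  · have := PD_comp h3 (LinearMap.codRestrict (LinearMap.ker (LinearMap.fst F F F)) (LinearMap.inr F F F) (by simp)).toAffineMap
    convert this using 1
    funext y
    have : (c, y) = ((0, y) + c • (1, 0) : F × F) := by simp
    rw [this]; rfl
  · rw [sl_card _ _ (by simp)] at h4
    simp only [pow_zero, mul_one] at h4
    rw [← h4]
    rw [← Set.ncard_image_of_injective (f := fun y : F => (c, y)) _ (by intro y y' h; simpa using h)]
    congr 1
    ext ⟨x, y⟩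
    simp only [Set.mem_image, Set.mem_ofPred_eq, LinearMap.fst_apply, Prod.mk.injEq]
    constructor
    · rintro ⟨y', h, rfl, rfl⟩; exact ⟨h, rfl⟩
    · rintro ⟨h, rfl⟩; exact ⟨y, h, rfl, rfl⟩

lemma collinear {al be : F → F} (h4 : 4 ≤ Fintype.card F) {s1 s0 : F} (hab : ∀ x, x ≠ 0 → al x ≠ be x) 
    (hs : ∀ x, x ≠ 0 → al x + be x = s1 * x + s0) :
    ∃ r t x1 x2 x3 : F, x1 ≠ 0 ∧ x2 ≠ 0 ∧ x3 ≠ 0 ∧ x1 ≠ x2 ∧ x1 ≠ x3 ∧ x2 ≠ x3 ∧ 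
      ∀ x, (x = x1 ∨ x = x2 ∨ x = x3) → (r * x + t = al x ∨ r * x + t = be x) := by
  classical
  let T : Finset F := (Finset.univ.erase 0).erase 1
  have hT : T.card = Fintype.card F - 2 := by
    rw [Finset.card_erase_of_mem (by simp), Finset.card_erase_of_mem (by simp), Finset.card_univ]; omega
  let D := T ×ˢ (Finset.univ : Finset Bool)
  have hD : D.card = 2 * (Fintype.card F - 2) := by
    simp [D, hT, mul_comm]
  let ga : F × Bool → F := fun p => if p.2 then al p.1 else be p.1
  let sg : F × Bool → F := fun p => (ga p - al 1) * (p.1 - 1)⁻¹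
  by_cases hinj : Set.InjOn sg D
  · exfalso
    have hc := Finset.card_image_of_injOn hinj
    have hle := Finset.card_le_univ (D.image sg)
    have hq : Fintype.card F = 4 := by omega
    have him : D.image sg = Finset.univ := Finset.eq_univ_of_card _ (by omega)
    have h4F : (4 : F) = 0 := by
      have := Nat.cast_card_eq_zero F
      rw [hq] at this
      exact_mod_cast this
    have h2F : (2 : F) = 0 := by
      have : (2 : F) * 2 = 0 := by rw [← h4F]; norm_num
      simpa using this
    have hsum0 : ∑ x : F, x = 0 := by
      have := FiniteField.sum_pow_lt_card_sub_one F 1 (by omega)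
      simpa using this
    have hinv : ∑ x : F, (x - 1)⁻¹ = 0 := by
      rw [← hsum0]
      exact Fintype.sum_bijective (fun x : F => (x - 1)⁻¹) 
        ((inv_involutive (G := F)).bijective.comp (Equiv.subRight (1:F)).bijective) _ _ (fun x => rfl)
    have hinvT : ∑ x ∈ T, (x - 1)⁻¹ = 1 := by
      have e1 := Finset.sum_erase_add (Finset.univ : Finset F) (fun x => (x - 1)⁻¹) (Finset.mem_univ 0)
      have e2 := Finset.sum_erase_add (Finset.univ.erase (0:F)) (fun x => (x - 1)⁻¹) (a := 1) (by simp)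
      rw [hinv] at e1
      have e3 : ((0:F) - 1)⁻¹ = -1 := by rw [zero_sub, inv_neg, inv_one]
      have e4 : ((1:F) - 1)⁻¹ = 0 := by rw [sub_self, inv_zero]
      simp only [e3] at e1
      simp only [e4] at e2
      show ∑ x ∈ (Finset.univ.erase 0).erase 1, (x - 1)⁻¹ = 1
      linear_combination e1 + e2
    have hs1 : ∑ p ∈ D, sg p = 0 := by
      rw [← hsum0, ← him, Finset.sum_image hinj]
    rw [Finset.sum_product] at hs1
    have hterm : ∀ x ∈ T, ∑ b : Bool, sg (x, b) = (s1 * 1 + s0) * (x - 1)⁻¹ + s1 := by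
      intro x hx
      simp [T] at hx
      have hx1 : x - 1 ≠ 0 := sub_ne_zero.2 hx.1
      have := hs x hx.2
      simp [sg, ga]
      field_simp
      linear_combination this - al 1 * h2F
    rw [Finset.sum_congr rfl hterm, Finset.sum_add_distrib, ← Finset.mul_sum, hinvT, Finset.sum_const, hT, hq] at hs1
    have h1 := hs 1 one_ne_zero
    apply hab 1 one_ne_zero
    simp at hs1
    linear_combination hs1 + h1 - (s1 + be 1) * h2F
  · simp only [Set.InjOn, not_forall] at hinj
    obtain ⟨⟨x, i⟩, hx, ⟨y, j⟩, hy, hxy, hne⟩ := hinj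
    simp [D, T] at hx hy
    replace hx := hx.symm
    replace hy := hy.symm
    have hx1 : x - 1 ≠ 0 := sub_ne_zero.2 hx.1
    have hy1 : y - 1 ≠ 0 := sub_ne_zero.2 hy.1
    have hga : ∀ z k, (k = true ∨ k = false) → (ga (z, k) = al z ∨ ga (z, k) = be z) := by
      rintro z k (rfl | rfl) <;> simp [ga]
    have ex : sg (x, i) * x + (al 1 - sg (x, i)) = ga (x, i) := by simp [sg]; field_simp; ring
    have ey : sg (x, i) * y + (al 1 - sg (x, i)) = ga (y, j) := by rw [hxy]; simp [sg]; field_simp; ring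
    have hxy' : x ≠ y := by
      rintro rfl
      have hg : ga (x, i) = ga (x, j) := by rw [← ex, ← ey]
      have h3 := hab x hx.2
      cases i <;> cases j <;> simp [ga] at hg hne
      · exact h3 hg.symm
      · exact h3 hg
    refine ⟨sg (x, i), al 1 - sg (x, i), 1, x, y, one_ne_zero, hx.2, hy.2, Ne.symm hx.1, Ne.symm hy.1, hxy', ?_⟩
    rintro z (rfl | rfl | rfl)
    · left; ring
    · rw [ex]; exact hga _ _ (by cases i <;> simp)
    · rw [ey]; exact hga _ _ (by cases j <;> simp)

lemma plane_big {f : F × F → F} (h4 : 4 ≤ Fintype.card F) (hf : f ∈ PD F (F × F) (Fintype.card F - 1)) 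
    (hz : ∀ y, f (0, y) = 0) {al be : F → F} (hab : ∀ x, x ≠ 0 → al x ≠ be x) 
    (hS : ∀ x, x ≠ 0 → ∀ y, f (x, y) ≠ 0 ↔ y = al x ∨ y = be x) : St1 F (fun p => f p ≠ 0) := by
  classical
  have sumx : ∀ (h : F × F → F) (x : F), x ≠ 0 → ∑ y, f (x, y) * h (x, y) = f (x, al x) * h (x, al x) + f (x, be x) * h (x, be x) := by
    intro h x hx
    rw [← Finset.sum_pair (f := fun y => f (x, y) * h (x, y)) (hab x hx)]
    symm
    apply Finset.sum_subset (Finset.subset_univ _)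
    intro y _ hy
    simp only [Finset.mem_insert, Finset.mem_singleton] at hy
    have : f (x, y) = 0 := by
      by_contra h; exact hy ((hS x hx y).1 h)
    simp [this]
  have sum0 : ∀ (h : F × F → F), ∑ y, f (0, y) * h (0, y) = 0 := by
    intro h; simp [hz]
  have hu : ∀ x, x ≠ 0 → f (x, al x) ≠ 0 := fun x hx => (hS x hx _).2 (Or.inl rfl)
  have hX : (fun p : F × F => p.1) ∈ PD F (F × F) 1 := by
    have := PD_aff (af (1:F) 0 0); simpa [af_apply] using this
  have hY : (fun p : F × F => p.2) ∈ PD F (F × F) 1 := by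
    have := PD_aff (af (0:F) 1 0); simpa [af_apply] using this
  -- zeroth moment
  have M0 : ∀ x, x ≠ 0 → f (x, be x) = - f (x, al x) := by
    obtain ⟨c, hc⟩ := PD_zero (push2 hf (PD_const (V := F × F) (1:F) 0))
    intro x hx
    have h0 := hc 0
    have h1 := hc x
    rw [sum0 (fun _ => 1)] at h0
    rw [sumx (fun _ => 1) x hx] at h1
    linear_combination h1 - h0
  let idA : F →ᵃ[F] F := (LinearMap.id : F →ₗ[F] F).toAffineMap
  have hid : ∀ x, idA x = x := by intro x; simp [idA]
  have hidl : idA.linear 1 = 1 := by simp [idA]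
  obtain ⟨ka, M1⟩ : ∃ ka, ∀ x, x ≠ 0 → f (x, al x) * (al x - be x) = ka * x := by
    obtain ⟨g, hg, h⟩ := PD_div (push2 hf hY) idA hidl (by intro x hx; rw [hid] at hx; rw [hx]; exact sum0 (fun p => p.2))
    obtain ⟨c, hc⟩ := PD_zero hg
    refine ⟨c, fun x hx => ?_⟩
    have h1 := h x
    rw [sumx (fun p => p.2) x hx, hid, hc, M0 x hx] at h1
    linear_combination h1
  have hka : ka ≠ 0 := by
    rintro rfl
    have := M1 1 one_ne_zero
    simp [hu 1 one_ne_zero, sub_ne_zero.2 (hab 1 one_ne_zero)] at this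
  obtain ⟨s1, s0, M2⟩ : ∃ s1 s0, ∀ x, x ≠ 0 → al x + be x = s1 * x + s0 := by
    obtain ⟨g, hg, h⟩ := PD_div (push2 hf (PD_mul hY hY)) idA hidl (by intro x hx; rw [hid] at hx; rw [hx]; exact sum0 (fun p => p.2 * p.2))
    obtain ⟨l, hl⟩ := PD_one hg
    refine ⟨l.linear 1 / ka, l 0 / ka, fun x hx => ?_⟩
    have h1 := h x
    have h2 := aff_shift l 0 1 x
    simp only [zero_add, smul_eq_mul, mul_one] at h2
    rw [sumx (fun p => p.2 * p.2) x hx, hid, hl, M0 x hx, h2] at h1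
    have h3 := M1 x hx
    have h4 : x * (ka * (al x + be x)) = x * (l 0 + x * l.linear 1) := by
      linear_combination h1 - (al x + be x) * h3
    have h5 := mul_left_cancel₀ hx h4
    field_simp
    linear_combination h5
  obtain ⟨r, t, x1, x2, x3, h1, h2, h3, h12, h13, h23, hL⟩ := collinear h4 hab M2
  have key : ∀ x, x ≠ 0 → (r * x + t - al x) * (r * x + t - be x) = 0 := by
    have p1 := PD_aff (af (-r) 1 (-t))
    have p2 := PD_aff (af (r - s1) 1 (t - s0))
    have hE := push2 hf (PD_mul (PD_mul p1 p2) hY)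
    have hv : ∀ x, x ≠ 0 → ∑ y, f (x, y) * (af (-r) 1 (-t) (x, y) * af (r - s1) 1 (t - s0) (x, y) * y) = - ka * x * ((r * x + t - al x) * (r * x + t - be x)) := by
      intro x hx
      rw [sumx (fun p => af (-r) 1 (-t) p * af (r - s1) 1 (t - s0) p * p.2) x hx, M0 x hx]
      simp only [af_apply]
      have e1 := M1 x hx
      have e2 := M2 x hx
      have e3 : s0 = al x + be x - s1 * x := by linear_combination -e2
      rw [e3]
      linear_combination (-(r * x + t - al x) * (r * x + t - be x)) * e1
    have hz4 := zeros1 (d := 1 + 1 + 1) (by omega) hE {0, x1, x2, x3} (by 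
      rw [Finset.card_insert_of_notMem (by simp [h1.symm, h2.symm, h3.symm]), Finset.card_insert_of_notMem (by simp [h12, h13]), Finset.card_pair h23]; omega) (by
      intro x hx
      simp only [Finset.mem_insert, Finset.mem_singleton] at hx
      rcases hx with rfl | hx
      · exact sum0 (fun p => af (-r) 1 (-t) p * af (r - s1) 1 (t - s0) p * p.2)
      · have hx0 : x ≠ 0 := by rcases hx with rfl | rfl | rfl <;> assumption
        rw [hv x hx0]
        rcases hL x hx with h | h <;> simp [h])
    intro x hx
    have := hz4 x
    rw [hv x hx] at this
    simpa [hka, hx] using this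
  have key2 : ∀ x, x ≠ 0 → ∀ y, f (x, y) ≠ 0 ↔ y = r * x + t ∨ y = (s1 - r) * x + (s0 - t) := by
    intro x hx y
    rw [hS x hx]
    have e2 := M2 x hx
    rcases mul_eq_zero.1 (key x hx) with h | h
    · have e3 : r * x + t = al x := by linear_combination h
      have e4 : (s1 - r) * x + (s0 - t) = be x := by linear_combination - h - e2
      rw [e3, e4]
    · have e3 : r * x + t = be x := by linear_combination h
      have e4 : (s1 - r) * x + (s0 - t) = al x := by linear_combination - h - e2
      rw [e3, e4, or_comm]
  have key3 : ∀ x, x ≠ 0 → (s1 - r - r) * x + (s0 - t - t) ≠ 0 := by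
    intro x hx h
    have e2 := M2 x hx
    apply hab x hx
    rcases mul_eq_zero.1 (key x hx) with h' | h'
    · linear_combination -2 * h' - e2 - h
    · linear_combination 2 * h' + e2 + h
  by_cases hd1 : s1 - r - r = 0
  · have hd0 : s0 - t - t ≠ 0 := by
      have := key3 1 one_ne_zero
      rw [hd1] at this
      simpa using this
    right; left
    refine ⟨af (-r / (s0 - t - t)) (1 / (s0 - t - t)) (-t / (s0 - t - t)), af 1 0 0, ⟨(0, s0 - t - t), (1, r), ?_, ?_, ?_, ?_⟩, ?_⟩
    · simp [af_lin, hd0]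
    · simp [af_lin]; field_simp; ring
    · simp [af_lin]
    · simp [af_lin]
    · rintro ⟨x, y⟩
      by_cases hx : x = 0
      · simp [hx, hz, af_apply]
      · have := key2 x hx y
        simp only [this, af_apply]
        have e1 : -r / (s0 - t - t) * x + 1 / (s0 - t - t) * y + -t / (s0 - t - t) = (y - (r * x + t)) / (s0 - t - t) := by
          field_simp; ring
        rw [e1, div_eq_zero_iff, div_eq_one_iff_eq hd0]
        have e5 : s1 = r + r := by linear_combination hd1
        simp only [hd0, or_false, one_mul, zero_mul, add_zero, ne_eq, hx, not_false_eq_true, and_true, sub_eq_zero]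
        refine or_congr Iff.rfl ?_
        rw [e5]
        constructor <;> intro h <;> linear_combination h
  · have hd0 : s0 - t - t = 0 := by
      by_contra hd0
      apply key3 (- (s0 - t - t) / (s1 - r - r)) (div_ne_zero (neg_ne_zero.2 hd0) hd1)
      field_simp; ring
    right; right
    refine ⟨af (-r) 1 (-t), af (-(s1 - r)) 1 (-t), 
      ⟨(1 / (s1 - r - r), (s1 - r) / (s1 - r - r)), (-1 / (s1 - r - r), -r / (s1 - r - r)), ?_, ?_, ?_, ?_⟩, ?_⟩
    · simp [af_lin]; field_simp; ring
    · simp [af_lin]; field_simp; ring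
    · simp [af_lin]; field_simp; ring
    · simp [af_lin]; field_simp; ring
    · rintro ⟨x, y⟩
      simp only [af_apply]
      by_cases hx : x = 0
      · simp [hx, hz]
      · rw [key2 x hx y]
        have h3 := key3 x hx
        have e5 : s0 - t = t := by linear_combination hd0
        rw [e5]
        have e6 : -r * x + 1 * y + -t = 0 ↔ y = r * x + t := by
          constructor <;> intro h <;> linear_combination h
        have e7 : -(s1 - r) * x + 1 * y + -t = 0 ↔ y = (s1 - r) * x + t := by
          constructor <;> intro h <;> linear_combination h
        rw [ne_eq, ne_eq, e6, e7]
        have : ¬ (y = r * x + t ∧ y = (s1 - r) * x + t) := by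
          rintro ⟨ha, hb⟩
          apply h3; linear_combination ha - hb + hd0
        tauto
end

set_option linter.unusedSectionVars false
section
variable {F : Type} [Field F] [Fintype F]

lemma plane0 (hq3 : 3 ≤ Fintype.card F) {f : F × F → F} (hf0 : f ≠ 0) (hf : f ∈ PD F (F × F) (Fintype.card F - 1)) 
    (hN : NZ f ≤ 2 * (Fintype.card F - 1)) (hz : ∀ y, f (0, y) = 0) : St1 F (fun p => f p ≠ 0) := by
  classical
  obtain ⟨hj, hc⟩ := cols hf0 hf hN hz
  have hout : ∀ x y, f (x, y) ≠ 0 → x ∈ hit (LinearMap.fst F F F) f := 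
    fun x y h => (mem_hit _ _ _).2 ⟨(x, y), h, rfl⟩
  by_cases h1 : (hit (LinearMap.fst F F F) f).card = 1
  · obtain ⟨c, hcc⟩ := Finset.card_eq_one.1 h1
    left
    refine ⟨af 1 0 (-c), ⟨(1, 0), by simp [af_lin]⟩, ?_⟩
    rintro ⟨x, y⟩
    have hin : c ∈ hit (LinearMap.fst F F F) f := by rw [hcc]; simp
    have h2 := (hc c hin).1
    rw [h1] at h2
    obtain ⟨d, hd⟩ := PD_zero h2
    obtain ⟨⟨x', y'⟩, hp, hp2⟩ := (mem_hit _ _ _).1 hin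
    simp at hp2
    subst hp2
    have hd0 : d ≠ 0 := by rw [← hd y']; exact hp
    have e : af 1 0 (-x') (x, y) = 0 ↔ x = x' := by
      simp [af_apply]; constructor <;> intro h <;> linear_combination h
    rw [e]
    constructor
    · intro h
      have := hout x y h
      rw [hcc] at this
      simpa using this
    · rintro rfl
      have := hd y
      show f (x, y) ≠ 0
      rwa [this]
  by_cases h2 : (hit (LinearMap.fst F F F) f).card = 2
  · obtain ⟨c1, c2, h12, hcc⟩ := Finset.card_eq_two.1 h2
    have hone : ∀ c ∈ hit (LinearMap.fst F F F) f, ∃ y0, ∀ y, f (c, y) ≠ 0 ↔ y ≠ y0 := by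
      intro c hcin
      have h3 := (hc c hcin).2
      have h4 := Set.ncard_add_ncard_compl {y | f (c, y) ≠ 0}
      rw [h3, h2, Nat.card_eq_fintype_card] at h4
      obtain ⟨y0, hy0⟩ := Set.ncard_eq_one.1 (show ({y | f (c, y) ≠ 0}ᶜ).ncard = 1 by omega)
      refine ⟨y0, fun y => ?_⟩
      have : y ∈ ({y | f (c, y) ≠ 0}ᶜ : Set F) ↔ y ∈ ({y0} : Set F) := by rw [hy0]
      simp at this
      rw [ne_eq, this]
    obtain ⟨y1, hy1⟩ := hone c1 (by simp [hcc])
    obtain ⟨y2, hy2⟩ := hone c2 (by simp [hcc])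
    have hd : c2 - c1 ≠ 0 := sub_ne_zero.2 h12.symm
    right; left
    refine ⟨af (1 / (c2 - c1)) 0 (-c1 / (c2 - c1)), af (-(y2 - y1) / (c2 - c1)) 1 (-y1 + (y2 - y1) * c1 / (c2 - c1)), 
      ⟨(c2 - c1, y2 - y1), (0, 1), ?_, ?_, ?_, ?_⟩, ?_⟩
    · simp [af_lin, hd]
    · simp [af_lin]
    · simp [af_lin]; field_simp; ring
    · simp [af_lin]
    · rintro ⟨x, y⟩
      have ea : af (1 / (c2 - c1)) 0 (-c1 / (c2 - c1)) (x, y) = (x - c1) / (c2 - c1) := by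
        simp [af_apply]; field_simp; ring
      have eb : af (-(y2 - y1) / (c2 - c1)) 1 (-y1 + (y2 - y1) * c1 / (c2 - c1)) (x, y) = y - y1 - (y2 - y1) * ((x - c1) / (c2 - c1)) := by
        simp [af_apply]; field_simp; ring
      rw [ea, eb]
      show f (x, y) ≠ 0 ↔ _
      by_cases hx1 : x = c1
      · subst hx1
        rw [hy1 y]
        simp [sub_eq_zero]
      by_cases hx2 : x = c2
      · subst hx2
        rw [hy2 y]
        simp [hd, sub_eq_zero]
      have : f (x, y) = 0 := by
        by_contra h
        have := hout x y h
        rw [hcc] at this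
        simp [hx1, hx2] at this
      rw [div_eq_zero_iff, div_eq_one_iff_eq hd]
      simp only [this, ne_eq, not_true_eq_false, false_iff, not_and, hd, or_false]
      rintro (h | h)
      · exact absurd (sub_eq_zero.1 h) hx1
      · exact absurd (sub_left_injective h) hx2
  · have h3 : (hit (LinearMap.fst F F F) f).card = Fintype.card F - 1 := by tauto
    have hsub : hit (LinearMap.fst F F F) f ⊆ Finset.univ.erase 0 := by
      intro x hx
      obtain ⟨⟨x', y'⟩, hp, hp2⟩ := (mem_hit _ _ _).1 hx
      simp at hp2
      subst hp2
      simp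
      rintro rfl
      exact hp (hz _)
    have hall : ∀ x, x ≠ 0 → x ∈ hit (LinearMap.fst F F F) f := by
      intro x hx
      rw [Finset.eq_of_subset_of_card_le hsub (by rw [Finset.card_erase_of_mem (Finset.mem_univ _), Finset.card_univ, h3])]
      simp [hx]
    have hpair : ∀ x, ∃ al be, x ≠ 0 → al ≠ be ∧ ∀ y, f (x, y) ≠ 0 ↔ y = al ∨ y = be := by
      intro x
      by_cases hx : x = 0
      · exact ⟨0, 0, fun h => absurd hx h⟩
      have h4 := (hc x (hall x hx)).2
      obtain ⟨al, be, hab, h5⟩ := Set.ncard_eq_two.1 (show {y | f (x, y) ≠ 0}.ncard = 2 by rw [h4, h3]; omega)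
      refine ⟨al, be, fun _ => ⟨hab, fun y => ?_⟩⟩
      have : y ∈ {y | f (x, y) ≠ 0} ↔ y ∈ ({al, be} : Set F) := by rw [h5]
      simpa using this
    choose al be hab using hpair
    exact plane_big (by omega) hf hz (fun x hx => (hab x hx).1) (fun x hx => (hab x hx).2)

lemma plane {V : Type} [AddCommGroup V] [Module F V] [Finite V] (hq3 : 3 ≤ Fintype.card F) 
    (hV : Module.finrank F V = 2) {f : V → F} (hf0 : f ≠ 0) (hf : f ∈ PD F V (Fintype.card F - 1)) 
    (hN : NZ f ≤ 2 * (Fintype.card F - 1)) : St1 F (fun p => f p ≠ 0) := by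
  classical
  obtain ⟨a, c, ha, hac⟩ := Mlem hq3 0 V hV f hf (by simpa using hN)
  obtain ⟨w, hw⟩ := exists_w ha
  have hK := finrank_ker' ha
  obtain ⟨b, hb⟩ := exists_dual (F := F) (V := LinearMap.ker a) (by omega)
  obtain ⟨z, hz⟩ := exists_w hb
  have haz : a z = 0 := z.2
  let B : V →ₗ[F] F := b ∘ₗ prj a w hw
  have hBz : B z = 1 := by
    have := prj_ker a w hw z 0
    simp at this
    simp [B, this, hz]
  have hBw : B w = 0 := by
    have := prj_ker a w hw 0 1
    simp at this
    simp [B, this]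
  let QL : V →ₗ[F] F × F := a.prod B
  let PL : F × F →ₗ[F] V := (LinearMap.toSpanSingleton F V w).coprod (LinearMap.toSpanSingleton F V (z : V))
  have hQP : ∀ p, QL (PL p) = p := by
    rintro ⟨x, y⟩
    simp [QL, PL, hw, haz, hBz, hBw]
  have hQs : Function.Surjective QL := fun p => ⟨_, hQP p⟩
  have hQi : Function.Injective QL := (LinearMap.injective_iff_surjective_of_finrank_eq_finrank (by simp [hV])).2 hQs
  have hPQ : ∀ x, PL (QL x) = x := fun x => hQi (hQP _)
  let P : F × F →ᵃ[F] V := PL.toAffineMap + AffineMap.const F _ (c • w)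
  let Q : V →ᵃ[F] F × F := QL.toAffineMap + AffineMap.const F _ (-(c, 0))
  have hP : ∀ p, P p = PL p + c • w := by intro p; simp [P]
  have hQ : ∀ x, Q x = QL x - (c, 0) := by intro x; simp [Q, sub_eq_add_neg]
  have hPQ' : ∀ x, P (Q x) = x := by
    intro x
    rw [hP, hQ, map_sub, hPQ]
    simp [PL]
  have hPi : Function.Injective P := by
    intro p p' h
    rw [hP, hP] at h
    have := add_right_cancel h
    rw [← hQP p, this, hQP]
  have hg := PD_comp hf P
  have hg0 : (fun p => f (P p)) ≠ 0 := by
    intro h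
    apply hf0
    funext x
    have := congrFun h (Q x)
    simpa [hPQ'] using this
  have hgN : NZ (fun p => f (P p)) ≤ 2 * (Fintype.card F - 1) := by
    refine le_trans ?_ hN
    unfold NZ
    rw [← Set.ncard_image_of_injective _ hPi]
    apply Set.ncard_le_ncard _ (Set.toFinite _)
    rintro _ ⟨p, hp, rfl⟩
    exact hp
  have hgz : ∀ y, f (P (0, y)) = 0 := by
    intro y
    apply hac
    rw [hP]
    simp [PL, hw, haz]
  have h1 := St1_comp (plane0 hq3 hg0 hg hgN hgz) Q (by 
    have : Q.linear = QL := by simp [Q]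
    rw [this]; exact hQs)
  simpa only [hPQ'] using h1

/-- the case `t = 1` -/
lemma main1 (hq3 : 3 ≤ Fintype.card F) (m : ℕ) : ∀ (V : Type) [AddCommGroup V] [Module F V] [Finite V], 
    Module.finrank F V = m + 2 → ∀ f : V → F, f ≠ 0 → f ∈ PD F V (Fintype.card F - 1) →
    NZ f ≤ 2 * (Fintype.card F - 1) * Fintype.card F ^ m → St1 F (fun p => f p ≠ 0) := by
  induction m with
  | zero => 
    intro V _ _ _ hV f hf0 hf hN
    exact plane hq3 hV hf0 hf (by simpa using hN)
  | succ m ih =>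
    intro V _ _ _ hV f hf0 hf hN
    obtain ⟨v, hv0, hinv⟩ := Vlem hq3 hV hf0 hf hN
    obtain ⟨g, hg⟩ := exists_dual_one (F := F) hv0
    have hcard := inv_card hg hinv
    have hK := finrank_ker' (ne_of_w hg)
    have heq : ∀ x, f x ≠ 0 ↔ sl g v f 0 (prj g v hg x) ≠ 0 := by
      intro x
      have := hinv x (-(g x))
      rw [← this]
      simp [sl, prj_coe, sub_eq_add_neg]
    have h0 : sl g v f 0 ≠ 0 := by
      intro h
      apply hf0
      funext x
      by_contra hx
      have := (heq x).1 hx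
      rw [h] at this
      exact this rfl
    have hq0 : 0 < Fintype.card F := by omega
    have hN' : NZ (sl g v f 0) ≤ 2 * (Fintype.card F - 1) * Fintype.card F ^ m := by
      rw [hcard, pow_succ] at hN
      apply Nat.le_of_mul_le_mul_left _ hq0
      calc _ ≤ _ := hN
        _ = _ := by ring
    have h1 := ih (LinearMap.ker g) (by omega) _ h0 (sl_PD0 g v hf 0) hN'
    have h2 := St1_comp h1 (prj g v hg).toAffineMap (by
      intro k
      exact ⟨k, by simpa using prj_ker g v hg k 0⟩)
    simp only [heq]
    exact h2
end

set_option linter.unusedSectionVars false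
section
variable {F : Type} [Field F] [Fintype F] {V : Type} [AddCommGroup V] [Module F V] [Finite V]

lemma Rlem {t k : ℕ} (hq3 : 3 ≤ Fintype.card F) (hk : 1 ≤ k) (hV : Module.finrank F V = t + k) {f : V → F}
    (hf : f ∈ PD F V (t * (Fintype.card F - 1))) {a : V →ₗ[F] F} {c : F} (h : ∃ x, f x ≠ 0 ∧ a x ≠ c) : 
    (fun x => f x * lmc a c x) ≠ 0 ∧
    (Fintype.card F - 1) * Fintype.card F ^ (k - 1) ≤ NZ (fun x => f x * lmc a c x) := by
  have hne : (fun x => f x * lmc a c x) ≠ 0 := by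
    obtain ⟨x, hx, hxc⟩ := h
    intro h0
    have := congrFun h0 x
    simp [lmc_apply, hx, sub_eq_zero, hxc] at this
  have := minwt (t + k) V hV t 1 _ (by omega) (by omega) hne (cut_PD hf a c)
  rw [show t + k - 1 - t = k - 1 by omega] at this
  exact ⟨hne, this⟩

lemma cutL {t k : ℕ} (hq3 : 3 ≤ Fintype.card F) (hk : 1 ≤ k) (hV : Module.finrank F V = (t + 1) + k) {f : V → F}
    (hf : f ∈ PD F V ((t + 1) * (Fintype.card F - 1))) 
    (hN : NZ f ≤ 2 * (Fintype.card F - 1) * Fintype.card F ^ (k - 1)) {a : V →ₗ[F] F} {c : F} 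
    (h : ∃ x, f x ≠ 0 ∧ a x ≠ c)
    (hW : (Fintype.card F - 1) * Fintype.card F ^ (k - 1) ≤ {x | f x ≠ 0 ∧ a x = c}.ncard) :
    ∃ (p : V) (D : Submodule F V), Module.finrank F D ≤ k ∧ (∀ x, f x ≠ 0 → a x ≠ c → x - p ∈ D) ∧
      (Fintype.card F - 1) * Fintype.card F ^ (k - 1) ≤ {x | (f x ≠ 0 ∧ a x ≠ c) ∧ x - p ∈ D}.ncard := by
  obtain ⟨hne, hR⟩ := Rlem hq3 hk hV hf h
  have hcut := cut_card f a c
  have hle : NZ (fun x => f x * lmc a c x) ≤ (Fintype.card F - 1) * Fintype.card F ^ (k - 1) := by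
    rw [mul_assoc] at hN
    omega
  obtain ⟨p, D, hD, hc⟩ := L14 hq3 hk t V hV _ hne (cut_PD hf a c) hle
  have hiff : ∀ x, f x * lmc a c x ≠ 0 ↔ (f x ≠ 0 ∧ a x ≠ c) := by
    intro x
    rw [mul_ne_zero_iff, lmc_apply, sub_ne_zero]
  refine ⟨p, D, hD, fun x hx hxc => all_of_card (hle.trans hc) x ((hiff x).2 ⟨hx, hxc⟩), ?_⟩
  simpa only [hiff] using hc

lemma Tlem {t k : ℕ} (hq3 : 3 ≤ Fintype.card F) (hk : 1 ≤ k) 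
    (hC : ∀ (V : Type) [AddCommGroup V] [Module F V] [Finite V], Module.finrank F V = (t + 1) + k → 
      ∀ f : V → F, f ≠ 0 → f ∈ PD F V ((t + 1) * (Fintype.card F - 1)) →
      NZ f ≤ 2 * (Fintype.card F - 1) * Fintype.card F ^ (k - 1) → 
      ∃ (p : V) (D : Submodule F V), Module.finrank F D ≤ k ∧ 
        (Fintype.card F - 1) * Fintype.card F ^ (k - 1) ≤ {x | f x ≠ 0 ∧ x - p ∈ D}.ncard)
    (hV : Module.finrank F V = (t + 2) + k) {f : V → F} (hf0 : f ≠ 0)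
    (hf : f ∈ PD F V ((t + 2) * (Fintype.card F - 1))) 
    (hN : NZ f ≤ 2 * (Fintype.card F - 1) * Fintype.card F ^ (k - 1)) :
    ∃ (a : V →ₗ[F] F) (c : F), a ≠ 0 ∧ ∀ x, f x ≠ 0 → a x = c := by
  by_contra! hno
  have hpos := NZ_pos hf0
  have hbig : (Fintype.card F - 1) * (NZ f - 1) < Fintype.card F ^ Module.finrank F V - 1 := by
    have h1 : (Fintype.card F - 1) * NZ f ≤ Fintype.card F ^ Module.finrank F V := by
      have h2 : Fintype.card F ^ 3 * Fintype.card F ^ (k - 1) ≤ Fintype.card F ^ Module.finrank F V := by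
        rw [← pow_add]
        apply Nat.pow_le_pow_right (by omega)
        omega
      refine le_trans ?_ h2
      refine (Nat.mul_le_mul_left _ hN).trans ?_
      rw [← mul_assoc]
      apply Nat.mul_le_mul_right
      obtain ⟨s, hs⟩ := Nat.exists_eq_add_of_le hq3
      rw [hs, show 3 + s - 1 = s + 2 by omega]
      nlinarith [Nat.zero_le s, Nat.zero_le (s*s), Nat.zero_le (s*s*s)]
    obtain ⟨y, hy⟩ := Nat.exists_eq_add_of_le hpos
    rw [hy] at h1 ⊢
    have h3 : (Fintype.card F - 1) * (1 + y) = (Fintype.card F - 1) + (Fintype.card F - 1) * y := by ring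
    rw [h3] at h1
    rw [show 1 + y - 1 = y by omega]
    omega
  obtain ⟨a, v, G, hav, hG0, hG, hGN, hGD⟩ := vred (r := (t + 1) * (Fintype.card F - 1)) 
    (by convert hf using 2; ring) hf0 hbig
  have hK := finrank_ker' (ne_of_w hav)
  obtain ⟨p, D, hD, hDc⟩ := hC (LinearMap.ker a) (by omega) G hG0 hG (hGN.trans hN)
  have hY := hDc.trans (hGD D p)
  have hYf := finrank_sup_span (D.map (LinearMap.ker a).subtype) v
  rw [finrank_map_sub] at hYf
  obtain ⟨a1, c1, ha1, h1⟩ := hyper_of_sub (F := F) (D := D.map (LinearMap.ker a).subtype ⊔ Submodule.span F {v}) (by omega) (p : V)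
  have hW1 := hY.trans (Set.ncard_le_ncard (t := {x | f x ≠ 0 ∧ a1 x = c1}) (fun x hx => ⟨hx.1, h1 x hx.2⟩) (Set.toFinite _))
  obtain ⟨z, hz, hzc⟩ := hno a1 c1 ha1
  obtain ⟨p2, D2, hD2, hall2, hcard2⟩ := cutL (t := t + 1) hq3 hk (by omega) hf hN ⟨z, hz, hzc⟩ hW1
  obtain ⟨a2, c2, ha2, h2⟩ := hyper_of_sub (F := F) (D := D2) (by omega) p2
  have hW2 := hcard2.trans (Set.ncard_le_ncard (t := {x | f x ≠ 0 ∧ a2 x = c2}) (fun x hx => ⟨hx.1.1, h2 x hx.2⟩) (Set.toFinite _))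
  obtain ⟨p3, D3, hD3, hall3, hcard3⟩ := cutL (t := t + 1) hq3 hk (by omega) hf hN (hno a2 c2 ha2) hW2
  have hY3 := finrank_sup_span D3 (z - p3)
  obtain ⟨a3, c3, ha3, h3⟩ := hyper_of_sub (F := F) (D := D3 ⊔ Submodule.span F {z - p3}) (by omega) p3
  have hz2 : a2 z = c2 := h2 z (hall2 z hz hzc)
  have hcard4 : {x | (f x ≠ 0 ∧ a2 x ≠ c2) ∧ x - p3 ∈ D3}.ncard + 1 ≤ {x | f x ≠ 0 ∧ a3 x = c3}.ncard := by
    rw [← Set.ncard_insert_of_notMem (a := z) (by simp [hz2]) (Set.toFinite _)]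
    apply Set.ncard_le_ncard _ (Set.toFinite _)
    intro x hx
    rcases hx with rfl | hx
    · exact ⟨hz, h3 _ (Submodule.mem_sup_right (Submodule.mem_span_singleton_self _))⟩
    · exact ⟨hx.1.1, h3 _ (Submodule.mem_sup_left hx.2)⟩
  have hR := (Rlem hq3 hk hV hf (hno a3 c3 ha3)).2
  have hcut := cut_card f a3 c3
  rw [mul_assoc] at hN
  omega

/-- cardinality of an affine subspace -/
lemma aff_card (W : AffineSubspace F V) (h : (W : Set V).Nonempty) : 
    (W : Set V).ncard = Fintype.card F ^ Module.finrank F W.direction := by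
  obtain ⟨p, hp⟩ := h
  rw [← card_V, ← Nat.card_coe_set_eq]
  apply Nat.card_congr
  exact { toFun := fun x => ⟨x.1 - p, AffineSubspace.vsub_mem_direction x.2 hp⟩
          invFun := fun d => ⟨d.1 + p, AffineSubspace.vadd_mem_of_mem_direction d.2 hp⟩
          left_inv := fun x => by simp
          right_inv := fun x => by simp }

lemma inter_card {k : ℕ} {G W1 W2 : AffineSubspace F V} (hG : Module.finrank F G.direction = k + 1) 
    (h1 : W1 ≤ G) (h2 : W2 ≤ G) (n1 : (W1 : Set V).Nonempty) (n2 : (W2 : Set V).Nonempty)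
    (d1 : Module.finrank F W1.direction = k) (d2 : Module.finrank F W2.direction = k) 
    (hne : W1.direction ≠ W2.direction) : 
    1 ≤ k ∧ ((W1 : Set V) ∩ W2).ncard = Fintype.card F ^ (k - 1) := by
  have hs : W1.direction ⊔ W2.direction = G.direction := by
    have hle : W1.direction ⊔ W2.direction ≤ G.direction := 
      sup_le (AffineSubspace.direction_le h1) (AffineSubspace.direction_le h2)
    apply Submodule.eq_of_le_of_finrank_le hle
    rw [hG]
    by_contra hlt
    apply hne
    have e1 : W1.direction = W1.direction ⊔ W2.direction := 
      Submodule.eq_of_le_of_finrank_le le_sup_left (by omega)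
    have e2 : W2.direction = W1.direction ⊔ W2.direction := 
      Submodule.eq_of_le_of_finrank_le le_sup_right (by omega)
    rw [e1, ← e2]
  have hf := Submodule.finrank_sup_add_finrank_inf_eq W1.direction W2.direction
  rw [hs, hG, d1, d2] at hf
  obtain ⟨p1, hp1⟩ := n1
  obtain ⟨p2, hp2⟩ := n2
  have hm : p2 - p1 ∈ W1.direction ⊔ W2.direction := by
    rw [hs]; exact AffineSubspace.vsub_mem_direction (h2 hp2) (h1 hp1)
  obtain ⟨u, hu, v, hv, huv⟩ := Submodule.mem_sup.1 hm
  have m1 : u + p1 ∈ W1 := AffineSubspace.vadd_mem_of_mem_direction hu hp1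
  have m2 : u + p1 ∈ W2 := by
    have := AffineSubspace.vadd_mem_of_mem_direction (W2.direction.neg_mem hv) hp2
    convert this using 1
    rw [vadd_eq_add, eq_neg_add_iff_add_eq, add_comm v, add_right_comm, huv]; simp
  have hc := aff_card (W1 ⊓ W2) ⟨u + p1, m1, m2⟩
  rw [AffineSubspace.direction_inf_of_mem m1 m2] at hc
  refine ⟨by omega, ?_⟩
  rw [show k - 1 = Module.finrank F (W1.direction ⊓ W2.direction : Submodule F V) by omega, ← hc]
  rfl
end

set_option linter.unusedSectionVars false
section
variable {F : Type} [Field F] [Fintype F] {V : Type} [AddCommGroup V] [Module F V] [Finite V]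

/-- support of type A or B -/
def AB (F : Type) [Field F] {V : Type} [AddCommGroup V] [Module F V] (k : ℕ) (S : Set V) : Prop := 
  ∃ G : AffineSubspace F V,
      (G : Set V).Nonempty ∧ Module.finrank F G.direction = k + 1 ∧
      S ⊆ (G : Set V) ∧
      ((∃ W1 W2 W' : AffineSubspace F V,
          W1 ≤ G ∧ W2 ≤ G ∧ W' ≤ G ∧
          (W1 : Set V).Nonempty ∧ (W2 : Set V).Nonempty ∧
          (W' : Set V).Nonempty ∧
          Module.finrank F W1.direction = k ∧
          Module.finrank F W2.direction = k ∧
          Module.finrank F W'.direction = k ∧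
          W1 ≠ W2 ∧ AffineSubspace.direction W1 = AffineSubspace.direction W2 ∧
          AffineSubspace.direction W' ≠ AffineSubspace.direction W1 ∧
          S = ((W1 : Set V) ∪ (W2 : Set V)) \ (W' : Set V)) ∨
       (∃ W1 W2 : AffineSubspace F V,
          W1 ≤ G ∧ W2 ≤ G ∧
          (W1 : Set V).Nonempty ∧ (W2 : Set V).Nonempty ∧
          Module.finrank F W1.direction = k ∧
          Module.finrank F W2.direction = k ∧
          AffineSubspace.direction W1 ≠ AffineSubspace.direction W2 ∧
          S = ((W1 : Set V) ∪ (W2 : Set V)) \ ((W1 : Set V) ∩ (W2 : Set V))))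

/-- flat support -/
def Flt (F : Type) [Field F] {V : Type} [AddCommGroup V] [Module F V] (k : ℕ) (S : Set V) : Prop := 
  ∃ W : AffineSubspace F V, (W : Set V).Nonempty ∧ Module.finrank F W.direction = k ∧ S = W

lemma diff_card {k : ℕ} {G W1 W2 : AffineSubspace F V} (hG : Module.finrank F G.direction = k + 1) 
    (h1 : W1 ≤ G) (h2 : W2 ≤ G) (n1 : (W1 : Set V).Nonempty) (n2 : (W2 : Set V).Nonempty)
    (d1 : Module.finrank F W1.direction = k) (d2 : Module.finrank F W2.direction = k) 
    (hne : W1.direction ≠ W2.direction) : 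
    ((W1 : Set V) \ W2).ncard = (Fintype.card F - 1) * Fintype.card F ^ (k - 1) := by
  obtain ⟨hk, h⟩ := inter_card hG h1 h2 n1 n2 d1 d2 hne
  have e := Set.ncard_sdiff_add_ncard_of_subset (s := (W1 : Set V) ∩ W2) (t := W1) Set.inter_subset_left (Set.toFinite _)
  rw [Set.sdiff_self_inter, h, aff_card W1 n1, d1] at e
  have e2 : Fintype.card F ^ k = Fintype.card F * Fintype.card F ^ (k - 1) := by
    rw [← pow_succ']; congr 1; omega
  rw [Nat.sub_mul, one_mul, ← e2]
  omega

lemma AB_card {k : ℕ} {S : Set V} (h : AB F k S) : S.ncard = 2 * (Fintype.card F - 1) * Fintype.card F ^ (k - 1) := by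
  rw [mul_assoc, two_mul]
  obtain ⟨G, hGn, hG, hS, ⟨W1, W2, W', h1, h2, h', n1, n2, n', d1, d2, d', hne, hp, hnp, rfl⟩ | ⟨W1, W2, h1, h2, n1, n2, d1, d2, hnp, rfl⟩⟩ := h
  · have c1 := diff_card hG h1 h' n1 n' d1 d' hnp.symm
    have c2 := diff_card hG h2 h' n2 n' d2 d' (by rw [← hp]; exact hnp.symm)
    rw [Set.union_sdiff_distrib, Set.ncard_union_eq, c1, c2]
    rw [Set.disjoint_left]
    rintro x ⟨hx1, _⟩ ⟨hx2, _⟩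
    apply hne
    exact AffineSubspace.ext_of_direction_eq hp ⟨x, hx1, hx2⟩
  · have c1 := diff_card hG h1 h2 n1 n2 d1 d2 hnp
    have c2 := diff_card hG h2 h1 n2 n1 d2 d1 hnp.symm
    have : ((W1 : Set V) ∪ (W2 : Set V)) \ ((W1 : Set V) ∩ (W2 : Set V)) = ((W1 : Set V) \ W2) ∪ ((W2 : Set V) \ W1) := by
      ext x; simp only [Set.mem_sdiff, Set.mem_union, Set.mem_inter_iff]; tauto
    rw [this, Set.ncard_union_eq, c1, c2]
    rw [Set.disjoint_left]
    rintro x ⟨hx1, _⟩ ⟨hx2, hx3⟩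
    exact hx3 hx1

lemma SF_C {k : ℕ} (hk : 1 ≤ k) {S : Set V} (h : Flt F k S ∨ AB F k S) : 
    ∃ (p : V) (D : Submodule F V), Module.finrank F D ≤ k ∧ 
      (Fintype.card F - 1) * Fintype.card F ^ (k - 1) ≤ {x | x ∈ S ∧ x - p ∈ D}.ncard := by
  rcases h with ⟨W, ⟨p, hp⟩, d, rfl⟩ | ⟨G, hGn, hG, hS, ⟨W1, W2, W', h1, h2, h', n1, n2, n', d1, d2, d', hne, hpa, hnp, rfl⟩ | ⟨W1, W2, h1, h2, n1, n2, d1, d2, hnp, rfl⟩⟩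
  · refine ⟨p, W.direction, d.le, ?_⟩
    have : {x | x ∈ (W : Set V) ∧ x - p ∈ W.direction} = W := by
      ext x
      simp only [Set.mem_ofPred_eq, and_iff_left_iff_imp]
      intro hx
      exact AffineSubspace.vsub_mem_direction hx hp
    rw [this, aff_card W ⟨p, hp⟩, d]
    calc _ ≤ Fintype.card F * Fintype.card F ^ (k - 1) := Nat.mul_le_mul_right _ (by omega)
      _ = _ := by rw [← pow_succ']; congr 1; omega
  · obtain ⟨p, hp⟩ := n1
    refine ⟨p, W1.direction, d1.le, ?_⟩
    rw [← diff_card hG h1 h' ⟨p, hp⟩ n' d1 d' hnp.symm]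
    apply Set.ncard_le_ncard _ (Set.toFinite _)
    rintro x ⟨hx, hx'⟩
    exact ⟨⟨Or.inl hx, hx'⟩, AffineSubspace.vsub_mem_direction hx hp⟩
  · obtain ⟨p, hp⟩ := n1
    refine ⟨p, W1.direction, d1.le, ?_⟩
    rw [← diff_card hG h1 h2 ⟨p, hp⟩ n2 d1 d2 hnp]
    apply Set.ncard_le_ncard _ (Set.toFinite _)
    rintro x ⟨hx, hx'⟩
    exact ⟨⟨Or.inl hx, fun h => hx' h.2⟩, AffineSubspace.vsub_mem_direction hx hp⟩

lemma SF_map {W : Type} [AddCommGroup W] [Module F W] {k : ℕ} {S : Set W} (h : Flt F k S ∨ AB F k S) 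
    (A : W →ᵃ[F] V) (hA : Function.Injective A) : Flt F k (A '' S) ∨ AB F k (A '' S) := by
  have hl : Function.Injective A.linear := (AffineMap.linear_injective_iff A).2 hA
  have hfr : ∀ U : AffineSubspace F W, Module.finrank F (U.map A).direction = Module.finrank F U.direction := by
    intro U
    rw [AffineSubspace.map_direction]
    exact (LinearEquiv.finrank_eq (Submodule.equivMapOfInjective A.linear hl U.direction)).symm
  have hdi : ∀ U U' : AffineSubspace F W, (U.map A).direction = (U'.map A).direction ↔ U.direction = U'.direction := by
    intro U U'
    rw [AffineSubspace.map_direction, AffineSubspace.map_direction]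
    exact (Submodule.map_injective_of_injective hl).eq_iff
  have hin : ∀ U U' : AffineSubspace F W, U.map A = U'.map A ↔ U = U' := by
    intro U U'
    rw [← SetLike.coe_set_eq, AffineSubspace.coe_map, AffineSubspace.coe_map, (hA.image_injective).eq_iff, SetLike.coe_set_eq]
  have hno : ∀ U : AffineSubspace F W, (U : Set W).Nonempty → ((U.map A : AffineSubspace F V) : Set V).Nonempty := by
    intro U hU
    rw [AffineSubspace.coe_map]; exact hU.image _
  rcases h with ⟨U, hU, d, rfl⟩ | ⟨G, hGn, hG, hS, h⟩
  · left
    exact ⟨U.map A, hno _ hU, by rw [hfr, d], by rw [AffineSubspace.coe_map]⟩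
  · right
    refine ⟨G.map A, hno _ hGn, by rw [hfr, hG], by rw [AffineSubspace.coe_map]; exact Set.image_mono hS, ?_⟩
    rcases h with ⟨W1, W2, W', h1, h2, h', n1, n2, n', d1, d2, d', hne, hpa, hnp, rfl⟩ | ⟨W1, W2, h1, h2, n1, n2, d1, d2, hnp, rfl⟩
    · left
      refine ⟨W1.map A, W2.map A, W'.map A, AffineSubspace.map_mono A h1, AffineSubspace.map_mono A h2, AffineSubspace.map_mono A h', 
        hno _ n1, hno _ n2, hno _ n', by rw [hfr, d1], by rw [hfr, d2], by rw [hfr, d'], ?_, ?_, ?_, ?_⟩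
      · rw [ne_eq, hin]; exact hne
      · rw [hdi]; exact hpa
      · rw [ne_eq, hdi]; exact hnp
      · rw [Set.image_sdiff hA, Set.image_union]; rfl
    · right
      refine ⟨W1.map A, W2.map A, AffineSubspace.map_mono A h1, AffineSubspace.map_mono A h2, 
        hno _ n1, hno _ n2, by rw [hfr, d1], by rw [hfr, d2], ?_, ?_⟩
      · rw [ne_eq, hdi]; exact hnp
      · rw [Set.image_sdiff hA, Set.image_union, Set.image_inter hA]; rfl

lemma zero_flat {k : ℕ} (hV : Module.finrank F V = k + 1) (a : V →ᵃ[F] F) {w : V} (hw : a.linear w = 1) (c : F) :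
    ∃ W : AffineSubspace F V, (W : Set V).Nonempty ∧ W.direction = LinearMap.ker a.linear ∧ 
      Module.finrank F W.direction = k ∧ ∀ x, x ∈ W ↔ a x = c := by
  let p : V := 0 + (c - a 0) • w
  have hp : a p = c := by
    rw [aff_shift, hw]; ring
  have hk := finrank_ker' (ne_of_w hw)
  refine ⟨AffineSubspace.mk' p (LinearMap.ker a.linear), ⟨p, AffineSubspace.self_mem_mk' _ _⟩, AffineSubspace.direction_mk' _ _, by rw [AffineSubspace.direction_mk']; omega, ?_⟩
  intro x
  rw [AffineSubspace.mem_mk', LinearMap.mem_ker, AffineMap.linearMap_vsub, hp, vsub_eq_sub, sub_eq_zero]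

lemma St1_SF {k : ℕ} (hV : Module.finrank F V = k + 1) {S : V → Prop} (h : St1 F S) : 
    Flt F k {x | S x} ∨ AB F k {x | S x} := by
  rcases h with ⟨a, ⟨w, hw⟩, h⟩ | ⟨a, b, ⟨w1, w2, ha1, ha2, hb1, hb2⟩, h⟩ | ⟨a, b, ⟨w1, w2, ha1, ha2, hb1, hb2⟩, h⟩
  · left
    obtain ⟨W, hn, hd, hf, hm⟩ := zero_flat hV a hw 0
    refine ⟨W, hn, hf, ?_⟩
    ext x
    rw [Set.mem_ofPred_eq, h, SetLike.mem_coe, hm]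
  · right
    obtain ⟨W1, n1, k1, d1, m1⟩ := zero_flat hV a ha1 0
    obtain ⟨W2, n2, k2, d2, m2⟩ := zero_flat hV a ha1 1
    obtain ⟨W', n', k', d', m'⟩ := zero_flat hV b hb2 0
    refine ⟨⊤, ⟨0, trivial⟩, by rw [AffineSubspace.direction_top, finrank_top, hV], fun x _ => trivial, Or.inl ⟨W1, W2, W', le_top, le_top, le_top, n1, n2, n', d1, d2, d', ?_, by rw [k1, k2], ?_, ?_⟩⟩
    · rintro rfl
      obtain ⟨x, hx⟩ := n1
      have e1 := (m1 x).1 hx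
      have e2 := (m2 x).1 hx
      rw [e1] at e2
      exact zero_ne_one e2
    · rw [k1, k']
      intro he
      have : w2 ∈ LinearMap.ker a.linear := ha2
      rw [← he, LinearMap.mem_ker, hb2] at this
      exact one_ne_zero this
    · ext x
      simp only [Set.mem_ofPred_eq, h, Set.mem_sdiff, Set.mem_union, SetLike.mem_coe, m1, m2, m']
  · right
    obtain ⟨W1, n1, k1, d1, m1⟩ := zero_flat hV a ha1 0
    obtain ⟨W2, n2, k2, d2, m2⟩ := zero_flat hV b hb2 0
    refine ⟨⊤, ⟨0, trivial⟩, by rw [AffineSubspace.direction_top, finrank_top, hV], fun x _ => trivial, Or.inr ⟨W1, W2, le_top, le_top, n1, n2, d1, d2, ?_, ?_⟩⟩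
    · rw [k1, k2]
      intro he
      have : w2 ∈ LinearMap.ker a.linear := ha2
      rw [he, LinearMap.mem_ker, hb2] at this
      exact one_ne_zero this
    · ext x
      simp only [Set.mem_ofPred_eq, h, Set.mem_sdiff, Set.mem_union, Set.mem_inter_iff, SetLike.mem_coe, m1, m2]
      tauto

lemma mainSF (hq3 : 3 ≤ Fintype.card F) {k : ℕ} (hk : 1 ≤ k) (t : ℕ) : ∀ (V : Type) [AddCommGroup V] [Module F V] [Finite V], 
    Module.finrank F V = (t + 1) + k → ∀ f : V → F, f ≠ 0 → f ∈ PD F V ((t + 1) * (Fintype.card F - 1)) →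
    NZ f ≤ 2 * (Fintype.card F - 1) * Fintype.card F ^ (k - 1) → 
    Flt F k {x | f x ≠ 0} ∨ AB F k {x | f x ≠ 0} := by
  induction t with
  | zero =>
    intro V _ _ _ hV f hf0 hf hN
    exact St1_SF (by omega) (main1 hq3 (k - 1) V (by omega) f hf0 (by simpa using hf) hN)
  | succ t ih =>
    intro V _ _ _ hV f hf0 hf hN
    obtain ⟨a, c, ha, hac⟩ := Tlem (t := t) hq3 hk 
      (fun V _ _ _ hV f hf0 hf hN => SF_C hk (ih V hV f hf0 hf hN)) hV hf0 hf hN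
    obtain ⟨w, hw⟩ := exists_w ha
    have hK := finrank_ker' ha
    obtain ⟨s0, sP, sN⟩ := slice_one hw hf0 hac hf
    have h1 := ih (LinearMap.ker a) (by omega) _ s0 (by 
      convert sP using 2
      rw [add_mul (t + 1) 1, one_mul, Nat.add_sub_cancel]) (by rw [sN]; exact hN)
    have h2 := SF_map h1 (slA a w c) (by
      intro x y hxy
      rw [slA_apply, slA_apply] at hxy
      exact Subtype.ext (add_right_cancel hxy))
    have h3 : slA a w c '' {k | sl a w f c k ≠ 0} = {x | f x ≠ 0} := by
      ext x
      simp only [Set.mem_image, Set.mem_ofPred_eq, slA_apply]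
      constructor
      · rintro ⟨k, hk, rfl⟩; exact hk
      · intro hx
        refine ⟨prj a w hw x, ?_, ?_⟩
        · simp [sl, prj_coe, hac x hx, hx]
        · simp [prj_coe, hac x hx]
    rwa [h3] at h2

lemma mainAB (hq3 : 3 ≤ Fintype.card F) {k t : ℕ} (hk : 1 ≤ k)
    (hV : Module.finrank F V = (t + 1) + k) {f : V → F} (hf : f ∈ PD F V ((t + 1) * (Fintype.card F - 1))) :
    NZ f = 2 * (Fintype.card F - 1) * Fintype.card F ^ (k - 1) ↔ AB F k {x | f x ≠ 0} := by
  constructor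
  · intro hN
    have hp : 0 < Fintype.card F ^ (k - 1) := by positivity
    have hf0 : f ≠ 0 := by
      rintro rfl
      simp [NZ] at hN
      omega
    rcases mainSF hq3 hk t V hV f hf0 hf hN.le with ⟨W, hW, d, h⟩ | h
    · exfalso
      unfold NZ at hN
      rw [h, aff_card W hW, d, show k = k - 1 + 1 by omega, pow_succ', Nat.add_sub_cancel] at hN
      have := Nat.eq_of_mul_eq_mul_right hp hN
      omega
    · exact h
  · exact AB_card

lemma RM_PD {r m : ℕ} {f : (Fin m → F) → F} (hf : ∃ P : MvPolynomial (Fin m) F, P.totalDegree ≤ r ∧ ∀ x, MvPolynomial.eval x P = f x) : 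
    f ∈ PD F (Fin m → F) r := by
  classical
  obtain ⟨P, hP, hPf⟩ := hf
  have hmono : ∀ (s : Finset (Fin m)) (e : Fin m → ℕ), (fun x : Fin m → F => ∏ i ∈ s, x i ^ e i) ∈ PD F (Fin m → F) (∑ i ∈ s, e i) := by
    intro s e
    have hpow : ∀ (i : Fin m) (n : ℕ), (fun x : Fin m → F => x i ^ n) ∈ PD F (Fin m → F) n := by
      intro i n
      induction n with
      | zero => simpa using PD_const (V := Fin m → F) (1 : F) 0
      | succ n ih => 
        simp_rw [pow_succ]
        exact PD_mul ih (PD_aff (LinearMap.proj i : (Fin m → F) →ₗ[F] F).toAffineMap)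
    induction s using Finset.induction_on with
    | empty => simpa using PD_const (V := Fin m → F) (1 : F) 0
    | insert i s hi ih =>
      simp_rw [Finset.prod_insert hi, Finset.sum_insert hi]
      exact PD_mul (hpow i _) ih
  have he : f = ∑ d ∈ P.support, P.coeff d • (fun x : Fin m → F => ∏ i, x i ^ d i) := by
    funext x
    rw [← hPf, MvPolynomial.eval_eq']
    simp
  rw [he]
  apply Submodule.sum_mem
  intro d hd
  apply Submodule.smul_mem
  apply PD_mono _ (hmono Finset.univ d)
  refine le_trans ?_ hP
  have := MvPolynomial.le_totalDegree hd
  rwa [Finsupp.sum_fintype _ _ (by simp)] at this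
end

/-- Characterization of second weight codewords of `R_q(t(q-1), m)`: the support lies in an
affine subspace of codimension `t-1` and is either (A) the union of two parallel affine
subspaces of codimension `t` minus their intersection with a non-parallel subspace of
codimension `t`, or (B) the union of two non-parallel affine subspaces of codimension `t`
minus their intersection. -/
theorem stmt16 {F : Type} [Field F] [Fintype F] [DecidableEq F] {m t : ℕ}
    (hq : 3 ≤ Fintype.card F) (hm : 2 ≤ m) (ht1 : 1 ≤ t) (ht2 : t ≤ m - 1)
    (f : (Fin m → F) → F) (hf : RM F (t * (Fintype.card F - 1)) m f) :
    wt f = 2 * (Fintype.card F - 1) * Fintype.card F ^ (m - t - 1) ↔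
    ∃ G : AffineSubspace F (Fin m → F),
      (G : Set (Fin m → F)).Nonempty ∧ Module.finrank F G.direction = m - (t - 1) ∧
      {x : Fin m → F | f x ≠ 0} ⊆ (G : Set (Fin m → F)) ∧
      ((∃ W1 W2 W' : AffineSubspace F (Fin m → F),
          W1 ≤ G ∧ W2 ≤ G ∧ W' ≤ G ∧
          (W1 : Set (Fin m → F)).Nonempty ∧ (W2 : Set (Fin m → F)).Nonempty ∧
          (W' : Set (Fin m → F)).Nonempty ∧
          Module.finrank F W1.direction = m - t ∧
          Module.finrank F W2.direction = m - t ∧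
          Module.finrank F W'.direction = m - t ∧
          W1 ≠ W2 ∧ AffineSubspace.direction W1 = AffineSubspace.direction W2 ∧
          AffineSubspace.direction W' ≠ AffineSubspace.direction W1 ∧
          {x : Fin m → F | f x ≠ 0} =
            ((W1 : Set (Fin m → F)) ∪ (W2 : Set (Fin m → F))) \ (W' : Set (Fin m → F))) ∨
       (∃ W1 W2 : AffineSubspace F (Fin m → F),
          W1 ≤ G ∧ W2 ≤ G ∧
          (W1 : Set (Fin m → F)).Nonempty ∧ (W2 : Set (Fin m → F)).Nonempty ∧
          Module.finrank F W1.direction = m - t ∧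
          Module.finrank F W2.direction = m - t ∧
          AffineSubspace.direction W1 ≠ AffineSubspace.direction W2 ∧
          {x : Fin m → F | f x ≠ 0} =
            ((W1 : Set (Fin m → F)) ∪ (W2 : Set (Fin m → F))) \
              ((W1 : Set (Fin m → F)) ∩ (W2 : Set (Fin m → F))))) := by
  have hw : wt f = NZ f := by
    unfold wt NZ
    rw [← Set.ncard_coe_finset]
    congr 1
    ext x
    simp
  have hk : 1 ≤ m - t := by omega
  have hfr : Module.finrank F (Fin m → F) = (t - 1 + 1) + (m - t) := by
    rw [Module.finrank_fin_fun]; omega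
  have h := mainAB (t := t - 1) hq hk hfr (f := f) (by rw [Nat.sub_add_cancel ht1]; exact RM_PD hf)
  rw [hw, h, show m - (t - 1) = m - t + 1 by omega]
  rfl
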